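/- arXiv:1105.1979 — 4 statements merged into one kernel-verified Lean document; each statement's English description precedes it below -/
import Mathlib

section
/- (Trivial shape is closed under approximation by sub-C*-algebras.) Let A be a separable C*-algebra such that for every finite subset F ⊆ A and every ε > 0 there exists a sub-C*-algebra B ⊆ A with F ⊂_ε B such that B is isomorphic to the inductive limit of an inductive system all of whose terms are projective C*-algebras. Then A itself is isomorphic to the inductive limit of an inductive system all of whose terms are projective C*-algebras. -/
open Filter Topology Set

noncomputable section

universe u v

/-- The iterated connecting morphisms `γ_{k+n,k} : A_k → A_{k+n}` of an inductive system. -/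
def iterHom {A : ℕ → Type u} [∀ k, NonUnitalCStarAlgebra (A k)]
    (γ : ∀ k, A k →⋆ₙₐ[ℂ] A (k + 1)) : ∀ k n : ℕ, A k →⋆ₙₐ[ℂ] A (k + n)
  | _, 0 => NonUnitalStarAlgHom.id ℂ _
  | k, n + 1 => (γ (k + n)).comp (iterHom γ k n)

/-- `(L, μ)` is the inductive limit of the inductive system `(A, γ)` of C*-algebras. -/
structure IsInductiveLimit {A : ℕ → Type u} [∀ k, NonUnitalCStarAlgebra (A k)]
    (γ : ∀ k, A k →⋆ₙₐ[ℂ] A (k + 1)) (L : Type v) [NonUnitalCStarAlgebra L]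
    (μ : ∀ k, A k →⋆ₙₐ[ℂ] L) : Prop where
  compat : ∀ k, (μ (k + 1)).comp (γ k) = μ k
  dense_union : Dense (⋃ k, Set.range (μ k))
  norm_tendsto : ∀ (k : ℕ) (a : A k),
    Tendsto (fun n => ‖iterHom γ k n a‖) atTop (𝓝 ‖μ k a‖)

/-- Two *-homomorphisms are homotopic if they are connected by a path of *-homomorphisms,
i.e. by a *-homomorphism into `C([0,1], B)`. -/
def Homotopic {A : Type u} {B : Type v} [NonUnitalCStarAlgebra A] [NonUnitalCStarAlgebra B]
    (φ ψ : A →⋆ₙₐ[ℂ] B) : Prop :=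
  ∃ H : A →⋆ₙₐ[ℂ] C(unitInterval, B), (∀ a, H a 0 = φ a) ∧ (∀ a, H a 1 = ψ a)

/-- A *-homomorphism is null-homotopic if it is homotopic to the zero morphism. -/
def NullHomotopic {A : Type u} {B : Type v} [NonUnitalCStarAlgebra A] [NonUnitalCStarAlgebra B]
    (φ : A →⋆ₙₐ[ℂ] B) : Prop :=
  Homotopic φ 0

/-- A C*-algebra is contractible if its identity is null-homotopic. -/
def Contractible (A : Type u) [NonUnitalCStarAlgebra A] : Prop :=
  NullHomotopic (NonUnitalStarAlgHom.id ℂ A)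

/-- A projective *-homomorphism between C*-algebras. -/
def IsProjectiveMorphism {A B : Type u} [NonUnitalCStarAlgebra A] [NonUnitalCStarAlgebra B]
    (φ : A →⋆ₙₐ[ℂ] B) : Prop :=
  ∀ (C D : Type u) [NonUnitalCStarAlgebra C] [NonUnitalCStarAlgebra D]
    (π : C →⋆ₙₐ[ℂ] D), Function.Surjective π → ∀ σ : B →⋆ₙₐ[ℂ] D,
    ∃ ψ : A →⋆ₙₐ[ℂ] C, π.comp ψ = σ.comp φ

/-- A projective C*-algebra. -/
def IsProjective (A : Type u) [NonUnitalCStarAlgebra A] : Prop :=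
  IsProjectiveMorphism (NonUnitalStarAlgHom.id ℂ A)

/-- A semiprojective *-homomorphism between C*-algebras. -/
def IsSemiprojectiveMorphism {A B : Type u} [NonUnitalCStarAlgebra A] [NonUnitalCStarAlgebra B]
    (φ : A →⋆ₙₐ[ℂ] B) : Prop :=
  ∀ (C : ℕ → Type u) [∀ k, NonUnitalCStarAlgebra (C k)]
    (δ : ∀ k, C k →⋆ₙₐ[ℂ] C (k + 1)), (∀ k, Function.Surjective (δ k)) →
    ∀ (L : Type u) [NonUnitalCStarAlgebra L] (μ : ∀ k, C k →⋆ₙₐ[ℂ] L),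
    IsInductiveLimit δ L μ → ∀ σ : B →⋆ₙₐ[ℂ] L,
    ∃ (k : ℕ) (ψ : A →⋆ₙₐ[ℂ] C k), (μ k).comp ψ = σ.comp φ

/-- A semiprojective C*-algebra. -/
def IsSemiprojective (A : Type u) [NonUnitalCStarAlgebra A] : Prop :=
  IsSemiprojectiveMorphism (NonUnitalStarAlgHom.id ℂ A)

/-- A weakly semiprojective *-homomorphism between C*-algebras. -/
def IsWeaklySemiprojectiveMorphism {A B : Type u} [NonUnitalCStarAlgebra A]
    [NonUnitalCStarAlgebra B] (φ : A →⋆ₙₐ[ℂ] B) : Prop :=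
  ∀ (C : ℕ → Type u) [∀ k, NonUnitalCStarAlgebra (C k)]
    (δ : ∀ k, C k →⋆ₙₐ[ℂ] C (k + 1)), (∀ k, Function.Surjective (δ k)) →
    ∀ (L : Type u) [NonUnitalCStarAlgebra L] (μ : ∀ k, C k →⋆ₙₐ[ℂ] L),
    IsInductiveLimit δ L μ → ∀ σ : B →⋆ₙₐ[ℂ] L,
    ∀ ε : ℝ, 0 < ε → ∀ F : Finset A,
    ∃ (k : ℕ) (ψ : A →⋆ₙₐ[ℂ] C k), ∀ x ∈ F, ‖μ k (ψ x) - σ (φ x)‖ < ε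

/-- A weakly semiprojective C*-algebra. -/
def IsWeaklySemiprojective (A : Type u) [NonUnitalCStarAlgebra A] : Prop :=
  IsWeaklySemiprojectiveMorphism (NonUnitalStarAlgHom.id ℂ A)

/-- A weakly projective C*-algebra. -/
def IsWeaklyProjective (A : Type u) [NonUnitalCStarAlgebra A] : Prop :=
  ∀ (C D : Type u) [NonUnitalCStarAlgebra C] [NonUnitalCStarAlgebra D]
    (π : C →⋆ₙₐ[ℂ] D), Function.Surjective π → ∀ σ : A →⋆ₙₐ[ℂ] D,
    ∀ ε : ℝ, 0 < ε → ∀ F : Finset A,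
    ∃ ψ : A →⋆ₙₐ[ℂ] C, ∀ x ∈ F, ‖π (ψ x) - σ x‖ < ε

/-- `F ⊂_ε G` : every element of `F` is within `ε` of some element of `G`. -/
def EpsContained {A : Type*} [NonUnitalCStarAlgebra A] (ε : ℝ) (F G : Set A) : Prop :=
  ∀ x ∈ F, ∃ y ∈ G, ‖x - y‖ < ε

/-- A subset of a C*-algebra which is a sub-C*-algebra. -/
def IsCStarSubset {A : Type*} [NonUnitalCStarAlgebra A] (S : Set A) : Prop :=
  IsClosed S ∧ (0 : A) ∈ S ∧ (∀ x ∈ S, ∀ y ∈ S, x + y ∈ S) ∧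
    (∀ x ∈ S, ∀ y ∈ S, x * y ∈ S) ∧ (∀ (c : ℂ), ∀ x ∈ S, c • x ∈ S) ∧ ∀ x ∈ S, star x ∈ S

/-- A C*-algebra is finitely generated if some finite subset is contained in no proper
sub-C*-algebra. -/
def IsFinitelyGeneratedCStar (A : Type*) [NonUnitalCStarAlgebra A] : Prop :=
  ∃ S : Finset A, ∀ T : Set A, IsCStarSubset T → ↑S ⊆ T → T = Set.univ

end
noncomputable section
universe w

/-- A bundled inductive system of C*-algebras. -/
structure CStarInductiveSystem : Type (w + 1) where
  X : ℕ → Type w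
  inst : ∀ k, NonUnitalCStarAlgebra (X k)
  conn : ∀ k, X k →⋆ₙₐ[ℂ] X (k + 1)

attribute [instance] CStarInductiveSystem.inst

/-- `A` is (isomorphic to) an inductive limit of projective C*-algebras,
i.e. `A` has trivial shape. -/
def IsInductiveLimitOfProjectives (A : Type w) [NonUnitalCStarAlgebra A] : Prop :=
  ∃ (S : CStarInductiveSystem.{w}) (μ : ∀ k, S.X k →⋆ₙₐ[ℂ] A),
    IsInductiveLimit S.conn A μ ∧ ∀ k, IsProjective (S.X k)

end

noncomputable section

universe u v

section StarHoms

variable {C D : Type*} [NonUnitalCStarAlgebra C] [NonUnitalCStarAlgebra D]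

lemma starHom_continuous (π : C →⋆ₙₐ[ℂ] D) : Continuous π :=
  AddMonoidHomClass.continuous_of_bound π 1 fun c => by
    simpa using NonUnitalStarAlgHom.norm_apply_le π c

/-- Self-adjoint elements in the range of a *-homomorphism lift to self-adjoint elements
without increasing a given bound on the norm. -/
lemma exists_isSelfAdjoint_lift (π : C →⋆ₙₐ[ℂ] D) (c : C) (hc : IsSelfAdjoint (π c)) {r : ℝ}
    (hr : ‖π c‖ ≤ r) : ∃ c', IsSelfAdjoint c' ∧ ‖c'‖ ≤ r ∧ π c' = π c := by
  have hr0 : 0 ≤ r := (norm_nonneg _).trans hr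
  set a : C := (1 / 2 : ℂ) • (c + star c) with ha
  have hsa : IsSelfAdjoint a := by
    rw [IsSelfAdjoint, ha, star_smul, star_add, star_star, add_comm]
    simp
  have hπa : π a = π c := by
    rw [ha, map_smul, map_add, map_star, hc.star_eq, ← two_smul ℂ, smul_smul]
    simp
  refine ⟨cfcₙ (fun t : ℝ => max (-r) (min r t)) a, cfcₙ_predicate _ a,
    norm_cfcₙ_le fun x _ => ?_, ?_⟩
  · rw [Real.norm_eq_abs, abs_le]
    exact ⟨le_max_left _ _, max_le (by linarith) (min_le_left _ _)⟩
  · have hπc : Continuous π := starHom_continuous π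
    rw [π.map_cfcₙ (fun t : ℝ => max (-r) (min r t)) a (by fun_prop) (by simp [hr0]) hπc hsa
      (by rw [hπa]; exact hc), hπa]
    conv_rhs => rw [← cfcₙ_id ℝ (π c)]
    refine cfcₙ_congr fun x hx => ?_
    have hx' : ‖x‖ ≤ r := by
      have := norm_apply_le_norm_cfcₙ (id : ℝ → ℝ) (π c) hx
      rw [cfcₙ_id ℝ (π c)] at this
      exact this.trans hr
    rw [Real.norm_eq_abs, abs_le] at hx'
    simp [hx'.1, hx'.2]

lemma exists_lift_norm_le (π : C →⋆ₙₐ[ℂ] D) (c : C) : ∃ c', ‖c'‖ ≤ 2 * ‖π c‖ ∧ π c' = π c := by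
  obtain ⟨x, -, hx, hπx⟩ := exists_isSelfAdjoint_lift π (realPart c : C) (r := ‖π c‖)
    ((realPart c).2.map π) ((by
      have h : π (realPart c : C) = (realPart (π c) : D) := by
        simp only [realPart_apply_coe, ← Complex.coe_smul, map_smul, map_add, map_star]
      rw [h]; exact realPart.norm_le (π c)))
  obtain ⟨y, -, hy, hπy⟩ := exists_isSelfAdjoint_lift π (imaginaryPart c : C) (r := ‖π c‖)
    ((imaginaryPart c).2.map π) ((by
      have h : π (imaginaryPart c : C) = (imaginaryPart (π c) : D) := by
        simp only [imaginaryPart_apply_coe, ← Complex.coe_smul, map_smul, map_sub, map_star]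
      rw [h]; exact imaginaryPart.norm_le (π c)))
  refine ⟨x + Complex.I • y, ?_, ?_⟩
  · refine (norm_add_le _ _).trans ?_
    rw [norm_smul, Complex.norm_I, one_mul]
    linarith
  · rw [map_add, map_smul, hπx, hπy, ← map_smul, ← map_add, realPart_add_I_smul_imaginaryPart]

/-- The range of a *-homomorphism between C*-algebras is closed. -/
lemma surjective_of_denseRange_starHom (π : C →⋆ₙₐ[ℂ] D) (h : DenseRange π) :
    Function.Surjective π := by
  let f : NormedAddGroupHom C D :=
    AddMonoidHom.mkNormedAddGroupHom (π : C →+ D) 1 fun c => by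
      simpa using NonUnitalStarAlgHom.norm_apply_le π c
  have key : f.SurjectiveOnWith f.range.topologicalClosure (2 + 1) := by
    refine controlled_closure_of_complete two_pos one_pos ?_
    rintro d hd
    obtain ⟨c, rfl⟩ := (f.mem_range d).1 hd
    obtain ⟨c', hc', hπ⟩ := exists_lift_norm_le π c
    exact ⟨c', hπ, hc'⟩
  intro d
  have hd : d ∈ f.range.topologicalClosure := h d
  obtain ⟨c, hc, -⟩ := key d hd
  exact ⟨c, hc⟩

/-- A densely defined, bounded graph that is closed and a *-subalgebra defines
a *-homomorphism. -/
lemma exists_starHom_of_graph (H : NonUnitalStarSubalgebra ℂ (C × D))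
    (hH : IsClosed (H : Set (C × D))) (hle : ∀ z ∈ H, ‖z.2‖ ≤ ‖z.1‖)
    (hd : Dense (Prod.fst '' (H : Set (C × D)))) :
    ∃ φ : C →⋆ₙₐ[ℂ] D, ∀ c, (c, φ c) ∈ H := by
  have huniq : ∀ {c : C} {d d' : D}, (c, d) ∈ H → (c, d') ∈ H → d = d' := by
    intro c d d' h h'
    have := hle _ (sub_mem h h')
    simpa [sub_eq_zero] using this
  let : NonUnitalCStarAlgebra H := NonUnitalStarSubalgebra.nonUnitalCStarAlgebra H
  let p : H →⋆ₙₐ[ℂ] C :=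
    (NonUnitalStarAlgHom.fst ℂ C D).comp (NonUnitalStarSubalgebraClass.subtype H)
  have hp : Function.Surjective p := by
    apply surjective_of_denseRange_starHom
    refine hd.mono ?_
    rintro _ ⟨z, hz, rfl⟩
    exact ⟨⟨z, hz⟩, rfl⟩
  have hex : ∀ c, ∃ d, (c, d) ∈ H := fun c => by
    obtain ⟨⟨⟨a, b⟩, hz⟩, rfl⟩ := hp c
    exact ⟨b, hz⟩
  choose φ hφ using hex
  exact ⟨{ toFun := φ
           map_smul' := fun r x => huniq (hφ _) (SMulMemClass.smul_mem r (hφ x))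
           map_zero' := huniq (hφ _) (zero_mem H)
           map_add' := fun x y => huniq (hφ _) (add_mem (hφ x) (hφ y))
           map_mul' := fun x y => huniq (hφ _) (mul_mem (hφ x) (hφ y))
           map_star' := fun x => huniq (hφ _) (star_mem (hφ x)) }, hφ⟩

/-- A pointwise limit of *-homomorphisms is a *-homomorphism. -/
lemma exists_starHom_tendsto (f : ℕ → C →⋆ₙₐ[ℂ] D) (hf : ∀ x, CauchySeq fun n => f n x) :
    ∃ φ : C →⋆ₙₐ[ℂ] D, ∀ x, Tendsto (fun n => f n x) atTop (𝓝 (φ x)) := by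
  choose φ hφ using fun x => cauchySeq_tendsto_of_complete (hf x)
  refine ⟨{ toFun := φ, map_smul' := ?_, map_zero' := ?_, map_add' := ?_, map_mul' := ?_,
            map_star' := ?_ }, hφ⟩
  · exact fun r x => tendsto_nhds_unique (hφ _) (by simpa using (hφ x).const_smul r)
  · exact tendsto_nhds_unique (hφ _) (by simp)
  · exact fun x y => tendsto_nhds_unique (hφ _) (by simpa using (hφ x).add (hφ y))
  · exact fun x y => tendsto_nhds_unique (hφ _) (by simpa using (hφ x).mul (hφ y))
  · exact fun x => tendsto_nhds_unique (hφ _) (by simpa [map_star] using (hφ x).star)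

end StarHoms

section Separability

lemma Subsemigroup.countable_closure {M : Type*} [Semigroup M] {s : Set M} (hs : s.Countable) :
    (Subsemigroup.closure s : Set M).Countable := by
  have := hs.to_subtype
  have : Countable (FreeSemigroup s) := by
    refine Function.Injective.countable (f := fun w : FreeSemigroup s => (w.head, w.tail)) ?_
    rintro ⟨a, l⟩ ⟨b, m⟩ h
    simpa using h
  have hle : Subsemigroup.closure s ≤ (FreeSemigroup.lift ((↑) : s → M)).srange :=
    Subsemigroup.closure_le.2 fun x hx => ⟨FreeSemigroup.of ⟨x, hx⟩, by simp⟩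
  exact (Set.countable_range (FreeSemigroup.lift ((↑) : s → M))).mono hle

lemma NonUnitalStarAlgebra.isSeparable_adjoin {A : Type*} [NonUnitalCStarAlgebra A] {s : Set A}
    (hs : s.Countable) :
    TopologicalSpace.IsSeparable (NonUnitalStarAlgebra.adjoin ℂ s : Set A) := by
  have hstar : (star s).Countable := by
    rw [← Set.image_star]
    exact hs.image _
  have h := (Subsemigroup.countable_closure (hs.union hstar)).isSeparable.span (R := ℂ)
  rwa [← NonUnitalStarAlgebra.adjoin_eq_span] at h

end Separability

/-- Formal *-polynomials without constant term in countably many variables. -/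
inductive StarTerm : Type
  | var (n : ℕ)
  | zero
  | add (s t : StarTerm)
  | mul (s t : StarTerm)
  | smul (r : ℂ) (s : StarTerm)
  | star (s : StarTerm)

namespace StarTerm

variable {C D : Type*} [NonUnitalCStarAlgebra C] [NonUnitalCStarAlgebra D]

/-- Evaluation of a *-polynomial at a sequence of elements of a C*-algebra. -/
def eval (c : ℕ → C) : StarTerm → C
  | var n => c n
  | zero => 0
  | add s t => eval c s + eval c t
  | mul s t => eval c s * eval c t
  | smul r s => r • eval c s
  | star s => Star.star (eval c s)

lemma map_eval (φ : C →⋆ₙₐ[ℂ] D) (c : ℕ → C) (w : StarTerm) :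
    φ (w.eval c) = w.eval fun n => φ (c n) := by
  induction w with
  | var n => rfl
  | zero => exact map_zero φ
  | add s t hs ht => simp only [eval, map_add, hs, ht]
  | mul s t hs ht => simp only [eval, map_mul, hs, ht]
  | smul r s hs => simp only [eval, map_smul, hs]
  | star s hs => simp only [eval, map_star, hs]

lemma exists_eval_of_mem_adjoin (c : ℕ → C) {x : C}
    (hx : x ∈ NonUnitalStarAlgebra.adjoin ℂ (Set.range c)) : ∃ w : StarTerm, w.eval c = x := by
  induction hx using NonUnitalStarAlgebra.adjoin_induction with
  | mem x hx => exact hx.imp' var fun _ h => h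
  | add x y _ _ hx hy =>
    obtain ⟨⟨s, rfl⟩, t, rfl⟩ := hx, hy
    exact ⟨add s t, rfl⟩
  | zero => exact ⟨zero, rfl⟩
  | mul x y _ _ hx hy =>
    obtain ⟨⟨s, rfl⟩, t, rfl⟩ := hx, hy
    exact ⟨mul s t, rfl⟩
  | smul r x _ hx =>
    obtain ⟨s, rfl⟩ := hx
    exact ⟨smul r s, rfl⟩
  | star x _ hx =>
    obtain ⟨s, rfl⟩ := hx
    exact ⟨star s, rfl⟩

lemma eval_mem (S : NonUnitalStarSubalgebra ℂ C) {c : ℕ → C} (hc : ∀ n, c n ∈ S)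
    (w : StarTerm) : w.eval c ∈ S := by
  induction w with
  | var n => exact hc n
  | zero => exact zero_mem S
  | add s t hs ht => exact add_mem hs ht
  | mul s t hs ht => exact mul_mem hs ht
  | smul r s hs => exact SMulMemClass.smul_mem r hs
  | star s hs => exact star_mem hs

/-- The function `N` arises as `w ↦ ‖w(c)‖` for a sequence `c` of self-adjoint contractions. -/
def IsNormFunction (N : StarTerm → ℝ) : Prop :=
  ∃ (C : Type u) (_ : NonUnitalCStarAlgebra C) (c : ℕ → C),
    (∀ n, IsSelfAdjoint (c n) ∧ ‖c n‖ ≤ 1) ∧ ∀ w : StarTerm, ‖w.eval c‖ = N w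

end StarTerm

/-- Evaluation at a coordinate, as a *-homomorphism on a bounded product of C*-algebras. -/
def lpEvalStarHom {I : Type v} (B : I → Type u) [∀ i, NonUnitalCStarAlgebra (B i)] (i : I) :
    lp B ⊤ →⋆ₙₐ[ℂ] B i where
  toFun f := f i
  map_smul' _ _ := rfl
  map_zero' := rfl
  map_add' _ _ := rfl
  map_mul' _ _ := rfl
  map_star' _ := rfl

/-- The universal C*-algebra generated by a sequence of self-adjoint contractions exists and is
separable. -/
lemma exists_universal_selfAdjoint_contractions :
    ∃ (F : Type u) (_ : NonUnitalCStarAlgebra F) (g : ℕ → F),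
      TopologicalSpace.SeparableSpace F ∧ (∀ n, IsSelfAdjoint (g n) ∧ ‖g n‖ ≤ 1) ∧
      Dense (Set.range fun w : StarTerm => w.eval g) ∧
      ∀ (C : Type u) [NonUnitalCStarAlgebra C] (c : ℕ → C),
        (∀ n, IsSelfAdjoint (c n) ∧ ‖c n‖ ≤ 1) → ∃ φ : F →⋆ₙₐ[ℂ] C, ∀ n, φ (g n) = c n := by
  choose B instB b hb hbN using
    fun N : {N : StarTerm → ℝ // StarTerm.IsNormFunction.{u} N} => N.2
  have hmem : ∀ n, Memℓp (fun N => b N n) ⊤ := fun n =>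
    memℓp_infty ⟨1, by rintro _ ⟨N, rfl⟩; exact (hb N n).2⟩
  let G : ℕ → lp B ⊤ := fun n => ⟨fun N => b N n, hmem n⟩
  have hG : ∀ n, IsSelfAdjoint (G n) ∧ ‖G n‖ ≤ 1 := fun n =>
    ⟨lp.ext (funext fun N => (hb N n).1), lp.norm_le_of_forall_le zero_le_one fun N => (hb N n).2⟩
  let S := (NonUnitalStarAlgebra.adjoin ℂ (Set.range G)).topologicalClosure
  have hS : IsClosed (S : Set (lp B ⊤)) := NonUnitalStarSubalgebra.isClosed_topologicalClosure _
  have hGS : ∀ n, G n ∈ S := fun n => NonUnitalStarSubalgebra.le_topologicalClosure _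
    (NonUnitalStarAlgebra.subset_adjoin ℂ _ ⟨n, rfl⟩)
  let instS : NonUnitalCStarAlgebra S := NonUnitalStarSubalgebra.nonUnitalCStarAlgebra S
  let incl : S →⋆ₙₐ[ℂ] lp B ⊤ := NonUnitalStarSubalgebraClass.subtype S
  let g : ℕ → S := fun n => ⟨G n, hGS n⟩
  have hdense : Dense (Set.range fun w : StarTerm => w.eval g) := by
    rw [Subtype.dense_iff]
    intro x hx
    refine closure_mono ?_ hx
    intro y hy
    obtain ⟨w, rfl⟩ := StarTerm.exists_eval_of_mem_adjoin G hy
    exact ⟨w.eval g, ⟨w, rfl⟩, StarTerm.map_eval incl g w⟩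
  refine ⟨S, instS, g, ?_, fun n => ⟨Subtype.ext (hG n).1, (hG n).2⟩, hdense, ?_⟩
  · exact ((NonUnitalStarAlgebra.isSeparable_adjoin (Set.countable_range G)).closure).separableSpace
  · intro C _ c hc
    let N : {N : StarTerm → ℝ // StarTerm.IsNormFunction.{u} N} :=
      ⟨fun w => ‖w.eval c‖, C, _, c, hc, fun _ => rfl⟩
    have hle : ∀ w : StarTerm, ‖w.eval c‖ ≤ ‖w.eval g‖ := fun w => by
      have h := NonUnitalStarAlgHom.norm_apply_le ((lpEvalStarHom B N).comp incl) (w.eval g)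
      rw [StarTerm.map_eval] at h
      exact (hbN N w).symm.le.trans h
    let p : ℕ → S × C := fun n => (g n, c n)
    let H := (NonUnitalStarAlgebra.adjoin ℂ (Set.range p)).topologicalClosure
    have hpH : ∀ n, p n ∈ H := fun n => NonUnitalStarSubalgebra.le_topologicalClosure _
      (NonUnitalStarAlgebra.subset_adjoin ℂ _ ⟨n, rfl⟩)
    have hfst : ∀ w : StarTerm, (w.eval p).1 = w.eval g :=
      StarTerm.map_eval (NonUnitalStarAlgHom.fst ℂ S C) p
    have hsnd : ∀ w : StarTerm, (w.eval p).2 = w.eval c :=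
      StarTerm.map_eval (NonUnitalStarAlgHom.snd ℂ S C) p
    have hHle : ∀ z ∈ H, ‖z.2‖ ≤ ‖z.1‖ := by
      have hcl : IsClosed {z : S × C | ‖z.2‖ ≤ ‖z.1‖} :=
        isClosed_le continuous_snd.norm continuous_fst.norm
      refine fun z hz => closure_minimal (fun z hz => ?_) hcl hz
      obtain ⟨w, rfl⟩ := StarTerm.exists_eval_of_mem_adjoin p hz
      simpa only [Set.mem_ofPred_eq, hfst, hsnd] using hle w
    obtain ⟨φ, hφ⟩ := exists_starHom_of_graph H
      (NonUnitalStarSubalgebra.isClosed_topologicalClosure _) hHle (hdense.mono (by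
        rintro _ ⟨w, rfl⟩
        exact ⟨w.eval p, StarTerm.eval_mem H hpH w, hfst w⟩))
    refine ⟨φ, fun n => ?_⟩
    have h := hHle _ (sub_mem (hφ (g n)) (hpH n))
    simpa [p, sub_eq_zero] using h

/-- There is a separable projective C*-algebra surjecting onto any given separable C*-algebra. -/
lemma exists_separable_projective_cover (A : Type u) [NonUnitalCStarAlgebra A]
    [TopologicalSpace.SeparableSpace A] :
    ∃ (F : Type u) (_ : NonUnitalCStarAlgebra F) (π : F →⋆ₙₐ[ℂ] A),
      TopologicalSpace.SeparableSpace F ∧ IsProjective F ∧ Function.Surjective π := by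
  obtain ⟨F, instF, g, hsep, hg, hdense, huniv⟩ := exists_universal_selfAdjoint_contractions.{u}
  have hgen : ∀ (C : Type u) [NonUnitalCStarAlgebra C] (φ ψ : F →⋆ₙₐ[ℂ] C),
      (∀ n, φ (g n) = ψ (g n)) → φ = ψ := by
    intro C _ φ ψ h
    refine DFunLike.coe_injective (Continuous.ext_on hdense (starHom_continuous φ)
      (starHom_continuous ψ) ?_)
    rintro _ ⟨w, rfl⟩
    simp only [StarTerm.map_eval, h]
  have hproj : IsProjective F := by
    intro C D _ _ π hπ σ
    have hlift : ∀ n, ∃ c, IsSelfAdjoint c ∧ ‖c‖ ≤ 1 ∧ π c = σ (g n) := fun n => by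
      obtain ⟨c, hc⟩ := hπ (σ (g n))
      rw [← hc]
      refine exists_isSelfAdjoint_lift π c (hc ▸ (hg n).1.map σ) ?_
      rw [hc]
      exact (NonUnitalStarAlgHom.norm_apply_le σ _).trans (hg n).2
    choose c hsa hnorm hc using hlift
    obtain ⟨ψ, hψ⟩ := huniv C c fun n => ⟨hsa n, hnorm n⟩
    refine ⟨ψ, hgen D _ _ fun n => ?_⟩
    simp [hψ, hc]
  have : Nonempty {a : A | IsSelfAdjoint a ∧ ‖a‖ ≤ 1} := ⟨⟨0, IsSelfAdjoint.zero A, by simp⟩⟩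
  obtain ⟨d, hd⟩ := TopologicalSpace.exists_dense_seq {a : A | IsSelfAdjoint a ∧ ‖a‖ ≤ 1}
  obtain ⟨π, hπ⟩ := huniv A (fun n => d n) fun n => (d n).2
  refine ⟨F, instF, π, hsep, hproj, ?_⟩
  apply surjective_of_denseRange_starHom
  have hcl : ∀ a : A, IsSelfAdjoint a → ‖a‖ ≤ 1 → a ∈ closure (Set.range π) := by
    intro a ha hn
    have := (Subtype.dense_iff.1 hd) (show a ∈ {a : A | IsSelfAdjoint a ∧ ‖a‖ ≤ 1} from ⟨ha, hn⟩)
    refine closure_mono ?_ this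
    rintro _ ⟨_, ⟨n, rfl⟩, rfl⟩
    exact ⟨g n, hπ n⟩
  let R : Submodule ℂ A := (LinearMap.range (π : F →ₗ[ℂ] A)).topologicalClosure
  have hR : ∀ a : A, IsSelfAdjoint a → a ∈ R := by
    intro a ha
    have h1 : ((‖a‖ : ℂ)⁻¹ • a) ∈ R := by
      refine hcl _ ?_ ?_
      · rw [IsSelfAdjoint, star_smul, ha.star_eq]; simp
      · rw [norm_smul, norm_inv, Complex.norm_real, norm_norm]
        exact inv_mul_le_one
    by_cases h0 : a = 0
    · simp [h0]
    · simpa [smul_smul, h0] using R.smul_mem (‖a‖ : ℂ) h1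
  intro a
  rw [← realPart_add_I_smul_imaginaryPart a]
  exact R.add_mem (hR _ (realPart a).2) (R.smul_mem _ (hR _ (imaginaryPart a).2))

section AsymptoticLifting

variable {Q D : Type u} [NonUnitalCStarAlgebra Q] [NonUnitalCStarAlgebra D]
  {C : ℕ → Type u} [∀ k, NonUnitalCStarAlgebra (C k)]

/-- A *-homomorphism from a projective C*-algebra to `D` lifts asymptotically along
*-homomorphisms `f k : C k → D` as soon as a dense set of elements of `D` lifts, compatibly with
the *-algebra operations, to sequences on which the `f k` are asymptotically isometric. -/
lemma IsProjective.exists_asymptotic_lift (hQ : IsProjective Q) (f : ∀ k, C k →⋆ₙₐ[ℂ] D)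
    (S : NonUnitalStarSubalgebra ℂ (lp C ⊤ × D))
    (hS : ∀ z ∈ S, Tendsto (fun k => f k (z.1 k)) atTop (𝓝 z.2) ∧
      Tendsto (fun k => ‖z.1 k‖) atTop (𝓝 ‖z.2‖))
    (hdense : Dense (Prod.snd '' (S : Set (lp C ⊤ × D)))) (σ : Q →⋆ₙₐ[ℂ] D) :
    ∃ ψ : ∀ k, Q →⋆ₙₐ[ℂ] C k, ∀ x, Tendsto (fun k => f k (ψ k x)) atTop (𝓝 (σ x)) ∧
      Tendsto (fun k => ‖ψ k x‖) atTop (𝓝 ‖σ x‖) := by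
  have happly : ∀ k (z w : lp C ⊤ × D), ‖(z.1 - w.1) k‖ ≤ ‖z - w‖ := fun k z w =>
    (lp.norm_apply_le_norm ENNReal.top_ne_zero _ k).trans (norm_fst_le (z - w))
  have hcl₁ : IsClosed {z : lp C ⊤ × D | Tendsto (fun k => f k (z.1 k)) atTop (𝓝 z.2)} := by
    refine Equicontinuous.isClosed_setOfPred_tendsto (F := fun k (z : lp C ⊤ × D) => f k (z.1 k))
      (LipschitzWith.uniformEquicontinuous _ 1 fun k => ?_).equicontinuous continuous_snd
    refine LipschitzWith.of_dist_le_mul fun z w => ?_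
    rw [dist_eq_norm, dist_eq_norm, ← map_sub, NNReal.coe_one, one_mul]
    exact (NonUnitalStarAlgHom.norm_apply_le (f k) _).trans (happly k z w)
  have hcl₂ : IsClosed {z : lp C ⊤ × D | Tendsto (fun k => ‖z.1 k‖) atTop (𝓝 ‖z.2‖)} := by
    refine Equicontinuous.isClosed_setOfPred_tendsto (F := fun k (z : lp C ⊤ × D) => ‖z.1 k‖)
      (LipschitzWith.uniformEquicontinuous _ 1 fun k => ?_).equicontinuous continuous_snd.norm
    refine LipschitzWith.of_dist_le_mul fun z w => ?_
    rw [dist_eq_norm, dist_eq_norm, NNReal.coe_one, one_mul, Real.norm_eq_abs]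
    exact (abs_norm_sub_norm_le _ _).trans (happly k z w)
  have hcl : ∀ z ∈ S.topologicalClosure, Tendsto (fun k => f k (z.1 k)) atTop (𝓝 z.2) ∧
      Tendsto (fun k => ‖z.1 k‖) atTop (𝓝 ‖z.2‖) :=
    fun z hz => closure_minimal (fun z hz => hS z hz) (hcl₁.inter hcl₂) hz
  have hclosed : IsClosed (S.topologicalClosure : Set (lp C ⊤ × D)) :=
    NonUnitalStarSubalgebra.isClosed_topologicalClosure _
  let T : Type u := S.topologicalClosure
  let instT : NonUnitalCStarAlgebra T :=
    NonUnitalStarSubalgebra.nonUnitalCStarAlgebra S.topologicalClosure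
  let incl : T →⋆ₙₐ[ℂ] lp C ⊤ × D := NonUnitalStarSubalgebraClass.subtype S.topologicalClosure
  let p : T →⋆ₙₐ[ℂ] D := (NonUnitalStarAlgHom.snd ℂ (lp C ⊤) D).comp incl
  have hp : Function.Surjective p := by
    apply surjective_of_denseRange_starHom
    refine hdense.mono ?_
    rintro _ ⟨z, hz, rfl⟩
    exact ⟨⟨z, NonUnitalStarSubalgebra.le_topologicalClosure _ hz⟩, rfl⟩
  obtain ⟨Ψ, hΨ⟩ := hQ T D p hp σ
  have hΨ' : ∀ x, (incl (Ψ x)).2 = σ x := fun x => DFunLike.congr_fun hΨ x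
  refine ⟨fun k => (lpEvalStarHom C k).comp
    ((NonUnitalStarAlgHom.fst ℂ (lp C ⊤) D).comp (incl.comp Ψ)), fun x => ?_⟩
  have h := hcl (incl (Ψ x)) (Ψ x).2
  rw [hΨ'] at h
  exact h

/-- Asymptotic lifting along subalgebras that asymptotically exhaust the target. -/
lemma IsProjective.exists_asymptotic_lift_of_injective (hQ : IsProjective Q)
    (ι : ∀ k, C k →⋆ₙₐ[ℂ] D) (hι : ∀ k, Function.Injective (ι k))
    (hdense : Dense {d : D | ∃ x : ∀ k, C k, Tendsto (fun k => ι k (x k)) atTop (𝓝 d)})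
    (σ : Q →⋆ₙₐ[ℂ] D) :
    ∃ ψ : ∀ k, Q →⋆ₙₐ[ℂ] C k, ∀ x, Tendsto (fun k => ι k (ψ k x)) atTop (𝓝 (σ x)) ∧
      Tendsto (fun k => ‖ψ k x‖) atTop (𝓝 ‖σ x‖) := by
  have hnorm : ∀ {x : ∀ k, C k} {d : D}, Tendsto (fun k => ι k (x k)) atTop (𝓝 d) →
      Tendsto (fun k => ‖x k‖) atTop (𝓝 ‖d‖) := fun h => by
    simpa only [NonUnitalStarAlgHom.norm_map _ (hι _)] using h.norm
  let S : NonUnitalStarSubalgebra ℂ (lp C ⊤ × D) :=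
    { carrier := {z | Tendsto (fun k => ι k (z.1 k)) atTop (𝓝 z.2)}
      add_mem' := fun {z w} hz hw => by
        simpa using Tendsto.add (f := fun k => ι k (z.1 k)) (g := fun k => ι k (w.1 k)) hz hw
      zero_mem' := by simp
      mul_mem' := fun {z w} hz hw => by
        simpa using Tendsto.mul (f := fun k => ι k (z.1 k)) (g := fun k => ι k (w.1 k)) hz hw
      smul_mem' := fun r z hz => by
        simpa using Tendsto.const_smul (f := fun k => ι k (z.1 k)) hz r
      star_mem' := fun {z} hz => by
        simpa [map_star] using Tendsto.star (f := fun k => ι k (z.1 k)) hz }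
  refine hQ.exists_asymptotic_lift ι S (fun z hz => ⟨hz, hnorm hz⟩) (hdense.mono ?_) σ
  rintro d ⟨x, hx⟩
  exact ⟨⟨⟨x, memℓp_infty (hnorm hx).bddAbove_range⟩, d⟩, hx, rfl⟩

lemma exists_coherent_sequence (γ : ∀ k, C k →⋆ₙₐ[ℂ] C (k + 1)) (k : ℕ) (a : C k) :
    ∃ x : ∀ j, C j, x k = a ∧ ∀ j, k ≤ j → x (j + 1) = γ j (x j) := by
  classical
  let r : ∀ j, k ≤ j → C j := fun j h => Nat.leRec (motive := fun j _ => C j) a (fun j _ => γ j) h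
  refine ⟨fun j => if h : k ≤ j then r j h else 0, ?_, fun j hj => ?_⟩
  · beta_reduce
    rw [dif_pos le_rfl]
    exact Nat.leRec_self _ _
  · beta_reduce
    rw [dif_pos hj, dif_pos (hj.trans j.le_succ)]
    exact Nat.leRec_succ _ _ hj

/-- Asymptotic lifting along an inductive limit. -/
lemma IsProjective.exists_asymptotic_lift_of_isInductiveLimit (hQ : IsProjective Q)
    {γ : ∀ k, C k →⋆ₙₐ[ℂ] C (k + 1)} {μ : ∀ k, C k →⋆ₙₐ[ℂ] D} (hμ : IsInductiveLimit γ D μ)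
    (σ : Q →⋆ₙₐ[ℂ] D) :
    ∃ ψ : ∀ k, Q →⋆ₙₐ[ℂ] C k, ∀ x, Tendsto (fun k => μ k (ψ k x)) atTop (𝓝 (σ x)) ∧
      Tendsto (fun k => ‖ψ k x‖) atTop (𝓝 ‖σ x‖) := by
  have hnorm : ∀ {x : ∀ k, C k} {d : D},
      (∀ᶠ j in atTop, x (j + 1) = γ j (x j) ∧ μ j (x j) = d) →
      Tendsto (fun k => ‖x k‖) atTop (𝓝 ‖d‖) := by
    intro x d h
    obtain ⟨J, hJ⟩ := eventually_atTop.1 h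
    have hx : ∀ n, x (J + n) = iterHom γ J n (x J) := by
      intro n
      induction n with
      | zero => rfl
      | succ n ih =>
        refine ((hJ (J + n) (Nat.le_add_right _ _)).1).trans ?_
        rw [ih]
        rfl
    have hlim := hμ.norm_tendsto J (x J)
    rw [(hJ J le_rfl).2] at hlim
    refine (tendsto_add_atTop_iff_nat J).1 (hlim.congr fun n => ?_)
    rw [← hx, add_comm]
  let S : NonUnitalStarSubalgebra ℂ (lp C ⊤ × D) :=
    { carrier := {z | ∀ᶠ j in atTop, z.1 (j + 1) = γ j (z.1 j) ∧ μ j (z.1 j) = z.2}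
      add_mem' := fun {z w} hz hw => by
        filter_upwards [hz, hw] with j h₁ h₂
        simp [h₁.1, h₁.2, h₂.1, h₂.2]
      zero_mem' := by simp
      mul_mem' := fun {z w} hz hw => by
        filter_upwards [hz, hw] with j h₁ h₂
        simp [h₁.1, h₁.2, h₂.1, h₂.2]
      smul_mem' := fun r z hz => by
        filter_upwards [hz] with j h
        simp [h.1, h.2]
      star_mem' := fun {z} hz => by
        filter_upwards [hz] with j h
        simp [h.1, h.2, map_star] }
  refine hQ.exists_asymptotic_lift μ S (fun z hz => ⟨?_, hnorm hz⟩) (hμ.dense_union.mono ?_) σ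
  · exact tendsto_const_nhds.congr' (hz.mono fun j h => h.2.symm)
  · intro d hd
    obtain ⟨k, a, rfl⟩ := mem_iUnion.1 hd
    obtain ⟨x, hxk, hx⟩ := exists_coherent_sequence γ k a
    have hμx : ∀ j, k ≤ j → μ j (x j) = μ k a := by
      intro j hj
      induction j, hj using Nat.le_induction with
      | base => rw [hxk]
      | succ j hj ih =>
        rw [hx j hj, ← ih]
        exact DFunLike.congr_fun (hμ.compat j) (x j)
    have hev : ∀ᶠ j in atTop, x (j + 1) = γ j (x j) ∧ μ j (x j) = μ k a :=
      eventually_atTop.2 ⟨k, fun j hj => ⟨hx j hj, hμx j hj⟩⟩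
    exact ⟨⟨⟨x, memℓp_infty (hnorm hev).bddAbove_range⟩, μ k a⟩, hev, rfl⟩

end AsymptoticLifting

/-- If `A` is approximated by inductive limits of projective C*-algebras, then a projective cover
`π : F → A` admits endomorphisms of `F` that are almost compatible with `π` and almost
isometric with respect to `π`, on any given finite set. -/
lemma exists_almost_isometric_endomorphism {A F : Type u} [NonUnitalCStarAlgebra A]
    [NonUnitalCStarAlgebra F] [TopologicalSpace.SeparableSpace A]
    (h : ∀ (G : Finset A) (ε : ℝ), 0 < ε →
      ∃ (B : Type u) (_ : NonUnitalCStarAlgebra B) (ι : B →⋆ₙₐ[ℂ] A),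
        Function.Injective ι ∧ EpsContained ε ↑G (Set.range ι) ∧
        IsInductiveLimitOfProjectives B)
    (hF : IsProjective F) (π : F →⋆ₙₐ[ℂ] A) (hπ : Function.Surjective π)
    (G : Finset F) {ε : ℝ} (hε : 0 < ε) :
    ∃ θ : F →⋆ₙₐ[ℂ] F, ∀ x ∈ G, ‖π (θ x) - π x‖ < ε ∧ ‖θ x‖ < ‖π x‖ + ε := by
  classical
  obtain ⟨d, hd⟩ := TopologicalSpace.exists_dense_seq A
  choose B instB ι hι hB hBlim using fun k : ℕ =>
    h ((Finset.range (k + 1)).image d) (1 / (k + 1)) Nat.one_div_pos_of_nat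
  have hdense : Dense {a : A | ∃ x : ∀ k, B k, Tendsto (fun k => ι k (x k)) atTop (𝓝 a)} := by
    refine hd.mono ?_
    rintro _ ⟨i, rfl⟩
    have hex : ∀ k, ∃ y : B k, i ≤ k → ‖d i - ι k y‖ < 1 / (k + 1) := by
      intro k
      by_cases hik : i ≤ k
      · obtain ⟨_, ⟨y, rfl⟩, hy⟩ := hB k (d i) (Finset.mem_coe.2
          (Finset.mem_image_of_mem d (Finset.mem_range.2 (Nat.lt_succ_of_le hik))))
        exact ⟨y, fun _ => hy⟩
      · exact ⟨0, fun h => absurd h hik⟩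
    choose x hx using hex
    refine ⟨x, tendsto_iff_norm_sub_tendsto_zero.2 ?_⟩
    refine squeeze_zero' (Eventually.of_forall fun _ => norm_nonneg _) ?_
      (tendsto_one_div_add_atTop_nhds_zero_nat (𝕜 := ℝ))
    filter_upwards [eventually_ge_atTop i] with k hk
    rw [norm_sub_rev]
    exact (hx k hk).le
  have hε2 : 0 < ε / 2 := half_pos hε
  have near : ∀ {E : Type u} [NonUnitalCStarAlgebra E] {a : E} {u : ℕ → E},
      Tendsto u atTop (𝓝 a) → ∀ᶠ k in atTop, ‖u k - a‖ < ε / 2 := fun hu => by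
    simpa only [dist_eq_norm] using Metric.tendsto_nhds.1 hu _ hε2
  have below : ∀ {r : ℝ} {u : ℕ → ℝ}, Tendsto u atTop (𝓝 r) → ∀ᶠ k in atTop, u k < r + ε / 2 :=
    fun hu => hu.eventually_lt_const (by linarith)
  obtain ⟨ψ, hψ⟩ := hF.exists_asymptotic_lift_of_injective ι hι hdense π
  obtain ⟨k, hk⟩ := ((Filter.eventually_all_finset G).2 fun x _ =>
    (near (hψ x).1).and (below (hψ x).2)).exists
  obtain ⟨S, μ, hμ, hS⟩ := hBlim k
  obtain ⟨ρ, hρ⟩ := hF.exists_asymptotic_lift_of_isInductiveLimit hμ (ψ k)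
  obtain ⟨j, hj⟩ := ((Filter.eventually_all_finset G).2 fun x _ =>
    (near (hρ x).1).and (below (hρ x).2)).exists
  obtain ⟨η, hη⟩ := hS j F A π hπ ((ι k).comp (μ j))
  have hη' : ∀ y, π (η y) = ι k (μ j y) := fun y => DFunLike.congr_fun hη y
  refine ⟨η.comp (ρ j), fun x hx => ⟨?_, ?_⟩⟩
  · calc ‖π (η (ρ j x)) - π x‖
        = ‖ι k (μ j (ρ j x) - ψ k x) + (ι k (ψ k x) - π x)‖ := by
          rw [hη', map_sub, sub_add_sub_cancel]
      _ ≤ ‖μ j (ρ j x) - ψ k x‖ + ‖ι k (ψ k x) - π x‖ :=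
          (norm_add_le _ _).trans
            (add_le_add (NonUnitalStarAlgHom.norm_apply_le (ι k) _) le_rfl)
      _ < ε := by linarith [(hj x hx).1, (hk x hx).1]
  · calc ‖η (ρ j x)‖ ≤ ‖ρ j x‖ := NonUnitalStarAlgHom.norm_apply_le η _
      _ < ‖π x‖ + ε := by linarith [(hj x hx).2, (hk x hx).2]

section StationarySystem

variable {F : Type u} [NonUnitalCStarAlgebra F]

lemma iterHom_succ_left (θ : ℕ → F →⋆ₙₐ[ℂ] F) (k n : ℕ) (x : F) :
    iterHom (A := fun _ => F) θ (k + 1) n (θ k x) = iterHom (A := fun _ => F) θ k (n + 1) x := by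
  induction n with
  | zero => rfl
  | succ n ih =>
    change θ (k + 1 + n) (iterHom (A := fun _ => F) θ (k + 1) n (θ k x)) =
      θ (k + (n + 1)) (iterHom (A := fun _ => F) θ k (n + 1) x)
    rw [ih, add_right_comm, add_assoc]

/-- The connecting maps of a stationary system can be chosen one after the other so that each is
adapted to all earlier iterates of the elements of a given sequence. -/
lemma exists_connecting_endomorphisms (d : ℕ → F) (P : ℕ → (F →⋆ₙₐ[ℂ] F) → F → Prop)
    (hP : ∀ n (G : Finset F), ∃ θ, ∀ x ∈ G, P n θ x) :
    ∃ θ : ℕ → F →⋆ₙₐ[ℂ] F, ∀ i k n, i ≤ k + n →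
      P (k + n) (θ (k + n)) (iterHom (A := fun _ => F) θ k n (d i)) := by
  classical
  choose step hstep using hP
  let pts : ℕ → Finset (F →⋆ₙₐ[ℂ] F) → Finset F := fun n Γ =>
    (Γ ×ˢ Finset.range (n + 1)).image fun q => q.1 (d q.2)
  let Γ : ℕ → Finset (F →⋆ₙₐ[ℂ] F) := fun n => Nat.rec {NonUnitalStarAlgHom.id ℂ F}
    (fun n Γ => insert (NonUnitalStarAlgHom.id ℂ F) (Γ.image (step n (pts n Γ)).comp)) n
  let θ : ℕ → F →⋆ₙₐ[ℂ] F := fun n => step n (pts n (Γ n))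
  have hid : ∀ n, NonUnitalStarAlgHom.id ℂ F ∈ Γ n := fun n => by
    cases n with
    | zero => exact Finset.mem_singleton_self _
    | succ n => exact Finset.mem_insert_self _ _
  have hiter : ∀ k n, iterHom (A := fun _ => F) θ k n ∈ Γ (k + n) := fun k n => by
    induction n with
    | zero => exact hid k
    | succ n ih => exact Finset.mem_insert_of_mem (Finset.mem_image_of_mem _ ih)
  refine ⟨θ, fun i k n hi => hstep (k + n) _ _ ?_⟩
  exact Finset.mem_image.2 ⟨(iterHom (A := fun _ => F) θ k n, i),
    Finset.mem_product.2 ⟨hiter k n, Finset.mem_range.2 (Nat.lt_succ_of_le hi)⟩, rfl⟩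

/-- A stationary system whose connecting maps are asymptotically compatible with, and
asymptotically isometric with respect to, a surjection `π : F → A` has inductive limit `A`. -/
lemma exists_isInductiveLimit_of_almost_compatible {A : Type u} [NonUnitalCStarAlgebra A]
    (π : F →⋆ₙₐ[ℂ] A) (hπ : Function.Surjective π) (θ : ℕ → F →⋆ₙₐ[ℂ] F) (d : ℕ → F)
    (hd : DenseRange d)
    (hcompat : ∀ i k n, i ≤ k + n →
      ‖π (iterHom (A := fun _ => F) θ k (n + 1) (d i)) -
        π (iterHom (A := fun _ => F) θ k n (d i))‖ < (1 / 2) ^ (k + n))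
    (hnorm : ∀ i k n, i ≤ k + n → ‖iterHom (A := fun _ => F) θ k (n + 1) (d i)‖ <
      ‖π (iterHom (A := fun _ => F) θ k n (d i))‖ + (1 / 2) ^ (k + n)) :
    ∃ μ : ℕ → F →⋆ₙₐ[ℂ] A, IsInductiveLimit (A := fun _ => F) θ A μ := by
  let g : ℕ → ℕ → F →⋆ₙₐ[ℂ] F := iterHom (A := fun _ => F) θ
  have hg : ∀ k n x, ‖g k n x‖ ≤ ‖x‖ := fun k n x => NonUnitalStarAlgHom.norm_apply_le _ x
  have hπg : ∀ k n x, ‖π (g k n x)‖ ≤ ‖x‖ := fun k n x =>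
    (NonUnitalStarAlgHom.norm_apply_le π _).trans (hg k n x)
  have hcauchy : ∀ k x, CauchySeq fun n => π (g k n x) := by
    intro k
    have hclosed : IsClosed {x : F | CauchySeq fun n => π (g k n x)} := by
      simp only [cauchySeq_iff_tendsto_dist_atTop_0]
      refine Equicontinuous.isClosed_setOfPred_tendsto
        (F := fun (m : ℕ × ℕ) (x : F) => dist (π (g k m.1 x)) (π (g k m.2 x)))
        (LipschitzWith.uniformEquicontinuous _ 2 fun m => ?_).equicontinuous continuous_const
      have hlip : ∀ n, LipschitzWith 1 fun x => π (g k n x) := fun n =>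
        LipschitzWith.of_dist_le_mul fun x y => by
          simpa [dist_eq_norm] using hπg k n (x - y)
      refine LipschitzWith.of_dist_le_mul fun x y => ?_
      have h₁ := (hlip m.1).dist_le_mul x y
      have h₂ := (hlip m.2).dist_le_mul x y
      have h := dist_dist_dist_le (π (g k m.1 x)) (π (g k m.2 x)) (π (g k m.1 y)) (π (g k m.2 y))
      simp only [NNReal.coe_one, one_mul, NNReal.coe_ofNat] at *
      linarith
    have hrange : Set.range d ⊆ {x : F | CauchySeq fun n => π (g k n x)} := by
      rintro _ ⟨i, rfl⟩
      refine (cauchySeq_shift i).1 ?_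
      refine cauchySeq_of_le_geometric (1 / 2) 1 (by norm_num) fun n => ?_
      rw [dist_comm, dist_eq_norm, one_mul, add_right_comm]
      refine (hcompat i k (n + i) (by omega)).le.trans ?_
      exact pow_le_pow_of_le_one (by norm_num) (by norm_num) (by omega)
    intro x
    exact closure_minimal hrange hclosed (hd x)
  choose μ hμ using fun k => exists_starHom_tendsto (fun n => π.comp (g k n)) (hcauchy k)
  replace hμ : ∀ k x, Tendsto (fun n => π (g k n x)) atTop (𝓝 (μ k x)) := hμ
  refine ⟨μ, ⟨fun k => ?_, ?_, fun k => ?_⟩⟩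
  · refine NonUnitalStarAlgHom.ext fun x => tendsto_nhds_unique (hμ (k + 1) (θ k x)) ?_
    refine ((tendsto_add_atTop_iff_nat 1).2 (hμ k x)).congr fun n => ?_
    rw [← iterHom_succ_left]
  · have hπd : Dense (Set.range fun i => π (d i)) :=
      hπ.denseRange.comp hd (starHom_continuous π)
    refine dense_closure.1 (hπd.mono ?_)
    rintro _ ⟨i, rfl⟩
    have hlim : Tendsto (fun k => μ k (d i)) atTop (𝓝 (π (d i))) := by
      refine tendsto_iff_dist_tendsto_zero.2 (squeeze_zero' (Eventually.of_forall fun _ =>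
        dist_nonneg) (g := fun k : ℕ => (1 / 2 : ℝ) ^ k / (1 - 1 / 2)) ?_ ?_)
      · filter_upwards [eventually_ge_atTop i] with k hk
        rw [dist_comm]
        refine dist_le_of_le_geometric_of_tendsto₀ (1 / 2) ((1 / 2) ^ k) (by norm_num)
          (f := fun n => π (g k n (d i))) (fun n => ?_) (hμ k (d i))
        rw [dist_comm, dist_eq_norm, ← pow_add]
        exact (hcompat i k n (by omega)).le
      · simpa using (tendsto_pow_atTop_nhds_zero_of_lt_one (r := (1 / 2 : ℝ)) (by norm_num)
          (by norm_num)).div_const (1 - 1 / 2)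
    exact mem_closure_of_tendsto hlim
      (Eventually.of_forall fun k => mem_iUnion.2 ⟨k, d i, rfl⟩)
  · have hclosed : IsClosed {x : F | Tendsto (fun n => ‖g k n x‖) atTop (𝓝 ‖μ k x‖)} := by
      refine Equicontinuous.isClosed_setOfPred_tendsto (F := fun n (x : F) => ‖g k n x‖)
        (LipschitzWith.uniformEquicontinuous _ 1 fun n => ?_).equicontinuous
        (starHom_continuous (μ k)).norm
      refine LipschitzWith.of_dist_le_mul fun x y => ?_
      rw [dist_eq_norm, dist_eq_norm, NNReal.coe_one, one_mul, Real.norm_eq_abs]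
      refine (abs_norm_sub_norm_le _ _).trans ?_
      rw [← map_sub]
      exact hg k n _
    have hrange : Set.range d ⊆ {x : F | Tendsto (fun n => ‖g k n x‖) atTop (𝓝 ‖μ k x‖)} := by
      rintro _ ⟨i, rfl⟩
      refine (tendsto_add_atTop_iff_nat 1).1 ?_
      have hpow : Tendsto (fun n : ℕ => (1 / 2 : ℝ) ^ (k + n)) atTop (𝓝 0) := by
        simpa only [add_comm] using (tendsto_add_atTop_iff_nat k).2
          (tendsto_pow_atTop_nhds_zero_of_lt_one (r := (1 / 2 : ℝ)) (by norm_num) (by norm_num))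
      refine tendsto_of_tendsto_of_tendsto_of_le_of_le'
        (g := fun n => ‖π (g k (n + 1) (d i))‖)
        (h := fun n => ‖π (g k n (d i))‖ + (1 / 2) ^ (k + n)) ?_ ?_ ?_ ?_
      · exact ((tendsto_add_atTop_iff_nat 1).2 (hμ k (d i))).norm
      · simpa using (hμ k (d i)).norm.add hpow
      · exact Eventually.of_forall fun n => NonUnitalStarAlgHom.norm_apply_le π _
      · filter_upwards [eventually_ge_atTop i] with n hn
        exact (hnorm i k n (by omega)).le
    intro x
    exact closure_minimal hrange hclosed (hd x)

end StationarySystem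

end

open TopologicalSpace in
/-- Trivial shape is closed under approximation by sub-C*-algebras: if a separable
C*-algebra `A` is approximated by sub-C*-algebras that are inductive limits of projective
C*-algebras, then `A` is itself an inductive limit of projective C*-algebras. -/
theorem trivialShape_closed_under_approximation
    (A : Type u) [NonUnitalCStarAlgebra A] [SeparableSpace A]
    (h : ∀ (F : Finset A) (ε : ℝ), 0 < ε →
      ∃ (B : Type u) (_ : NonUnitalCStarAlgebra B) (ι : B →⋆ₙₐ[ℂ] A),
        Function.Injective ι ∧ EpsContained ε ↑F (Set.range ι) ∧
        IsInductiveLimitOfProjectives B) :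
    IsInductiveLimitOfProjectives A := by
  obtain ⟨F, instF, π, hsep, hF, hπ⟩ := exists_separable_projective_cover A
  obtain ⟨d, hd⟩ := TopologicalSpace.exists_dense_seq F
  obtain ⟨θ, hθ⟩ := exists_connecting_endomorphisms d
    (fun n θ x => ‖π (θ x) - π x‖ < (1 / 2) ^ n ∧ ‖θ x‖ < ‖π x‖ + (1 / 2) ^ n)
    fun n G => exists_almost_isometric_endomorphism h hF π hπ G (by positivity)
  obtain ⟨μ, hμ⟩ := exists_isInductiveLimit_of_almost_compatible π hπ θ d hd
    (fun i k n hi => (hθ i k n hi).1) (fun i k n hi => (hθ i k n hi).2)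
  exact ⟨⟨fun _ => F, fun _ => instF, θ⟩, μ, hμ, fun _ => hF⟩
end

section
/- Let A be a separable C*-algebra that is isomorphic to the inductive limit of an inductive system of projective C*-algebras (equivalently, A has trivial shape). Then A is isomorphic to the inductive limit of an inductive system of projective C*-algebras in which every connecting *-homomorphism is surjective. -/
open Filter Topology Set

noncomputable section

open scoped CStarAlgebra

section Small

/-- The closure of a small set in a first-countable Hausdorff space is small. -/
theorem small_closure {E : Type v} [TopologicalSpace E] [FrechetUrysohnSpace E] [T2Space E]
    (s : Set E) [Small.{u} s] : Small.{u} (closure s) := by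
  rcases isEmpty_or_nonempty E with hE | hE
  · infer_instance
  · have hsub : closure s ⊆ Set.range fun x : ℕ → s => limUnder atTop fun n => (x n : E) := by
      intro a ha
      obtain ⟨x, hx, hlim⟩ := mem_closure_iff_seq_limit.mp ha
      exact ⟨fun n => ⟨x n, hx n⟩, hlim.limUnder_eq⟩
    exact small_subset hsub

/-- A non-unital subalgebra generated by a small set is small. -/
theorem NonUnitalAlgebra.small_adjoin {R : Type} {E : Type v} [CommRing R]
    [NonUnitalRing E] [Module R E] [IsScalarTower R E E] [SMulCommClass R E E]
    (s : Set E) [Small.{u} s] : Small.{u} (NonUnitalAlgebra.adjoin R s : Set E) := by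
  let f := FreeNonUnitalNonAssocAlgebra.lift R fun x : Shrink.{u} s => ((equivShrink s).symm x : E)
  have hsub : (NonUnitalAlgebra.adjoin R s : Set E) ⊆ Set.range f := by
    have hle : NonUnitalAlgebra.adjoin R s ≤ NonUnitalAlgHom.range f := by
      refine NonUnitalAlgebra.adjoin_le fun x hx => ?_
      exact ⟨FreeNonUnitalNonAssocAlgebra.of R (equivShrink s ⟨x, hx⟩),
        (FreeNonUnitalNonAssocAlgebra.lift_of_apply ..).trans (by simp)⟩
    intro x hx
    simpa using hle hx
  exact small_subset hsub

/-- A non-unital star subalgebra generated by a small set is small. -/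
theorem NonUnitalStarAlgebra.small_adjoin {R : Type} {E : Type v} [CommRing R] [StarRing R]
    [NonUnitalRing E] [StarRing E] [Module R E] [IsScalarTower R E E] [SMulCommClass R E E]
    [StarModule R E] (s : Set E) [Small.{u} s] :
    Small.{u} (NonUnitalStarAlgebra.adjoin R s : Set E) := by
  have : Small.{u} (star s : Set E) := by
    rw [← Set.image_star]; infer_instance
  exact NonUnitalAlgebra.small_adjoin (R := R) (s ∪ star s)

/-- The C*-algebra structure transported to a small model of a C*-algebra. -/
@[reducible]
def shrinkNonUnitalCStarAlgebra (U : Type v) [NonUnitalCStarAlgebra U] [Small.{u} U] :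
    NonUnitalCStarAlgebra (Shrink.{u} U) :=
  let e : Shrink.{u} U ≃+* U := Shrink.ringEquiv U
  let l : Shrink.{u} U ≃ₗ[ℂ] U := Shrink.linearEquiv ℂ U
  letI : NonUnitalNormedRing (Shrink.{u} U) :=
    NonUnitalNormedRing.induced (Shrink.{u} U) U e e.injective
  letI : StarRing (Shrink.{u} U) :=
    { star := fun x => e.symm (star (e x))
      star_involutive := fun _ => by simp
      star_mul := fun x y => by simp
      star_add := fun x y => by simp }
  have hstar : ∀ x : Shrink.{u} U, e (star x) = star (e x) := fun x => e.apply_symm_apply _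
  have hnorm : ∀ x : Shrink.{u} U, ‖x‖ = ‖e x‖ := fun x => rfl
  have hsmul : ∀ (c : ℂ) (x : Shrink.{u} U), e (c • x) = c • e x := map_smul l
  { norm_smul_le := fun c x => by rw [hnorm, hnorm, hsmul]; exact norm_smul_le c (e x)
    smul_assoc := fun c x y => e.injective (by
      simp only [smul_eq_mul, map_mul, hsmul, smul_mul_assoc])
    smul_comm := fun c x y => e.injective (by
      simp only [smul_eq_mul, map_mul, hsmul, mul_smul_comm])
    star_smul := fun c x => e.injective (by simp only [hstar, hsmul, star_smul])
    norm_mul_self_le := fun x => by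
      rw [hnorm, hnorm, map_mul, hstar]
      exact CStarRing.norm_mul_self_le (e x)
    toCompleteSpace := by
      have hi : Isometry e := AddMonoidHomClass.isometry_of_norm e fun _ => rfl
      exact (hi.isUniformInducing.completeSpace_congr e.surjective).2 inferInstance }

/-- Every small C*-algebra is isomorphic to one in the smaller universe. -/
theorem exists_starAlgEquiv_of_small (U : Type v) [NonUnitalCStarAlgebra U] [Small.{u} U] :
    ∃ (B : Type u) (_ : NonUnitalCStarAlgebra B), Nonempty (B ≃⋆ₐ[ℂ] U) :=
  ⟨Shrink.{u} U, shrinkNonUnitalCStarAlgebra U,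
    letI := shrinkNonUnitalCStarAlgebra U
    ⟨{ Shrink.ringEquiv U with
        map_star' := fun _ => (Shrink.ringEquiv U).apply_symm_apply _
        map_smul' := (Shrink.linearEquiv ℂ U).map_smul }⟩⟩

end Small

section Coproduct

/-- A cocone over a family of C*-algebras. -/
structure CStarCocone {ι : Type} (A : ι → Type u) [∀ i, NonUnitalCStarAlgebra (A i)] :
    Type (u + 1) where
  X : Type u
  inst : NonUnitalCStarAlgebra X
  hom : ∀ i, A i →⋆ₙₐ[ℂ] X

attribute [instance] CStarCocone.inst

variable {ι : Type} {A : ι → Type u} [∀ i, NonUnitalCStarAlgebra (A i)]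

/-- The canonical map from a C*-algebra into the bounded product of all cocones under it. -/
def toProductOfCocones (i : ι) : A i →⋆ₙₐ[ℂ] lp (fun r : CStarCocone A => r.X) ⊤ where
  toFun a := ⟨fun r => r.hom i a, memℓp_infty ⟨‖a‖, by
    rintro _ ⟨r, rfl⟩; exact NonUnitalStarAlgHom.norm_apply_le _ a⟩⟩
  map_smul' c a := lp.ext (funext fun r => map_smul (r.hom i) c a)
  map_zero' := lp.ext (funext fun r => map_zero (r.hom i))
  map_add' a b := lp.ext (funext fun r => map_add (r.hom i) a b)
  map_mul' a b := lp.ext (funext fun r => map_mul (r.hom i) a b)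
  map_star' a := lp.ext (funext fun r => map_star (r.hom i) a)

/-- The projection of the bounded product of all cocones onto one of them. -/
def productOfCoconesProj (r : CStarCocone A) :
    lp (fun r : CStarCocone A => r.X) ⊤ →⋆ₙₐ[ℂ] r.X where
  toFun x := x r
  map_smul' _ _ := rfl
  map_zero' := rfl
  map_add' _ _ := rfl
  map_mul' _ _ := rfl
  map_star' _ := rfl

/-- The data exhibiting a C*-algebra `B` as the coproduct (full free product) of a family:
maps out of `B` can be prescribed on each factor, and the factors generate `B`. -/
structure IsCStarCoproduct {B : Type u} [NonUnitalCStarAlgebra B] (j : ∀ i, A i →⋆ₙₐ[ℂ] B) :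
    Prop where
  exists_desc : ∀ (D : Type u) [NonUnitalCStarAlgebra D] (f : ∀ i, A i →⋆ₙₐ[ℂ] D),
    ∃ g : B →⋆ₙₐ[ℂ] D, ∀ i a, g (j i a) = f i a
  generates : ∀ S : NonUnitalStarSubalgebra ℂ B, IsClosed (S : Set B) →
    (∀ i a, j i a ∈ S) → ∀ b, b ∈ S

variable (A) in
/-- Coproducts of families of C*-algebras exist. -/
theorem exists_isCStarCoproduct :
    ∃ (B : Type u) (_ : NonUnitalCStarAlgebra B) (j : ∀ i, A i →⋆ₙₐ[ℂ] B),
      IsCStarCoproduct j := by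
  let E := lp (fun r : CStarCocone A => r.X) ⊤
  let s : Set E := Set.range fun x : Σ i, A i => toProductOfCocones x.1 x.2
  let T : NonUnitalStarSubalgebra ℂ E := (NonUnitalStarAlgebra.adjoin ℂ s).topologicalClosure
  have hT : IsClosed (T : Set E) := NonUnitalStarSubalgebra.isClosed_topologicalClosure _
  have hsT : ∀ i a, toProductOfCocones (A := A) i a ∈ T := fun i a =>
    NonUnitalStarSubalgebra.le_topologicalClosure _
      (NonUnitalStarAlgebra.subset_adjoin ℂ s ⟨⟨i, a⟩, rfl⟩)
  have : Small.{u} (NonUnitalStarAlgebra.adjoin ℂ s : Set E) :=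
    NonUnitalStarAlgebra.small_adjoin s
  have : Small.{u} T := small_closure (NonUnitalStarAlgebra.adjoin ℂ s : Set E)
  obtain ⟨B, _, ⟨e⟩⟩ := exists_starAlgEquiv_of_small.{_, u} T
  let j : ∀ i, A i →⋆ₙₐ[ℂ] B := fun i =>
    (e.symm : T →⋆ₙₐ[ℂ] B).comp (NonUnitalStarAlgHom.codRestrict (toProductOfCocones i) T (hsT i))
  have hj : ∀ i a, e (j i a) = ⟨toProductOfCocones i a, hsT i a⟩ := fun i a =>
    e.apply_symm_apply _
  refine ⟨B, inferInstance, j, ⟨fun D _ f => ?_, fun S hS hjS b => ?_⟩⟩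
  · refine ⟨((productOfCoconesProj ⟨D, inferInstance, f⟩).comp
      (NonUnitalStarSubalgebraClass.subtype T)).comp (e : B →⋆ₙₐ[ℂ] T), fun i a => ?_⟩
    change productOfCoconesProj ⟨D, inferInstance, f⟩ (e (j i a) : E) = f i a
    rw [hj]
    rfl
  · let S' : NonUnitalStarSubalgebra ℂ E :=
      (S.map (e : B →⋆ₙₐ[ℂ] T)).map (NonUnitalStarSubalgebraClass.subtype T)
    have hS' : IsClosed (S' : Set E) := by
      have he : IsClosed (e '' (S : Set B)) := by
        have hi : Isometry e := AddMonoidHomClass.isometry_of_norm e fun _ =>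
          StarAlgEquiv.norm_map e _
        exact (hi.isClosedEmbedding.isClosedMap) _ hS
      exact hT.isClosedEmbedding_subtypeVal.isClosedMap _ he
    have hle : T ≤ S' := by
      refine NonUnitalStarSubalgebra.topologicalClosure_minimal _
        (NonUnitalStarAlgebra.adjoin_le ?_) hS'
      rintro _ ⟨⟨i, a⟩, rfl⟩
      exact ⟨e (j i a), ⟨j i a, hjS i a, rfl⟩, congrArg Subtype.val (hj i a)⟩
    obtain ⟨t, ⟨b', hb', rfl⟩, h⟩ := hle (e b).2
    have : b' = b := e.injective (Subtype.ext h)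
    exact this ▸ hb'

namespace IsCStarCoproduct

variable {B : Type u} [NonUnitalCStarAlgebra B] {j : ∀ i, A i →⋆ₙₐ[ℂ] B}

theorem hom_ext (h : IsCStarCoproduct j) {D : Type u} [NonUnitalCStarAlgebra D]
    {f g : B →⋆ₙₐ[ℂ] D} (hfg : ∀ i a, f (j i a) = g (j i a)) : f = g := by
  ext b
  exact h.generates (NonUnitalStarAlgHom.equalizer f g)
    (isClosed_eq (map_continuous f) (map_continuous g)) hfg b

/-- The coproduct of projective C*-algebras is projective. -/
theorem isProjective (h : IsCStarCoproduct j) (hA : ∀ i, IsProjective (A i)) :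
    IsProjective B := by
  intro C D _ _ π hπ σ
  choose f hf using fun i => hA i C D π hπ (σ.comp (j i))
  obtain ⟨ψ, hψ⟩ := h.exists_desc C f
  refine ⟨ψ, h.hom_ext fun i a => ?_⟩
  simpa [hψ] using DFunLike.congr_fun (hf i) a

end IsCStarCoproduct

end Coproduct

section IterHom

variable {A : ℕ → Type u} [∀ k, NonUnitalCStarAlgebra (A k)] (γ : ∀ k, A k →⋆ₙₐ[ℂ] A (k + 1))

theorem iterHom_add_heq (k m n : ℕ) (a : A k) :
    HEq (iterHom γ (k + m) n (iterHom γ k m a)) (iterHom γ k (m + n) a) := by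
  induction n with
  | zero => exact HEq.rfl
  | succ n ih =>
    have step : ∀ {i j : ℕ} (_ : i = j) {x : A i} {y : A j}, HEq x y → HEq (γ i x) (γ j y) := by
      rintro i _ rfl x y h
      rw [eq_of_heq h]
    exact step (Nat.add_assoc k m n) ih

theorem norm_iterHom_iterHom (k m n : ℕ) (a : A k) :
    ‖iterHom γ (k + m) n (iterHom γ k m a)‖ = ‖iterHom γ k (m + n) a‖ := by
  have norm_eq : ∀ {i j : ℕ} (_ : i = j) {x : A i} {y : A j}, HEq x y → ‖x‖ = ‖y‖ := by
    rintro i _ rfl x y h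
    rw [eq_of_heq h]
  exact norm_eq (Nat.add_assoc k m n) (iterHom_add_heq γ k m n a)

variable {γ} {L : Type v} [NonUnitalCStarAlgebra L] {μ : ∀ k, A k →⋆ₙₐ[ℂ] L}

theorem map_iterHom (hμ : ∀ k, (μ (k + 1)).comp (γ k) = μ k) (k n : ℕ) (a : A k) :
    μ (k + n) (iterHom γ k n a) = μ k a := by
  induction n with
  | zero => rfl
  | succ n ih => exact (DFunLike.congr_fun (hμ (k + n)) _).trans ih

/-- A compatible cocone with dense union of ranges is an inductive limit as soon as the norms of
the images along the system get arbitrarily close to the norm in the limit. -/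
theorem IsInductiveLimit.of_norm_lt (hμ : ∀ k, (μ (k + 1)).comp (γ k) = μ k)
    (hd : Dense (⋃ k, Set.range (μ k)))
    (h : ∀ k a, ∀ ε > 0, ∃ n, ‖iterHom γ k n a‖ < ‖μ k a‖ + ε) : IsInductiveLimit γ L μ where
  compat := hμ
  dense_union := hd
  norm_tendsto k a := by
    have hanti : Antitone fun n => ‖iterHom γ k n a‖ :=
      antitone_nat_of_succ_le fun n => NonUnitalStarAlgHom.norm_apply_le (γ (k + n)) _
    refine Metric.tendsto_atTop.2 fun ε hε => ?_
    obtain ⟨N, hN⟩ := h k a ε hε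
    refine ⟨N, fun n hn => ?_⟩
    have hlow : ‖μ k a‖ ≤ ‖iterHom γ k n a‖ :=
      map_iterHom hμ k n a ▸ NonUnitalStarAlgHom.norm_apply_le (μ (k + n)) _
    rw [Real.dist_eq, abs_of_nonneg (sub_nonneg.2 hlow)]
    linarith [hanti hn]

end IterHom

section Telescope

variable {P : ℕ → Type u} [∀ k, NonUnitalCStarAlgebra (P k)] {γ : ∀ k, P k →⋆ₙₐ[ℂ] P (k + 1)}
  {B : ℕ → Type u} [∀ k, NonUnitalCStarAlgebra (B k)]
  {j : ∀ k, ∀ i : {i : ℕ // k ≤ i}, P i →⋆ₙₐ[ℂ] B k}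

/-- The connecting map between the coproducts of consecutive tails of an inductive system: the
first factor is pushed forward along the system, the other ones are left alone. -/
theorem exists_telescope_conn (hj : ∀ k, IsCStarCoproduct (j k)) (k : ℕ) :
    ∃ c : B k →⋆ₙₐ[ℂ] B (k + 1),
      (∀ a, c (j k ⟨k, le_rfl⟩ a) = j (k + 1) ⟨k + 1, le_rfl⟩ (γ k a)) ∧
      ∀ (i : ℕ) (h : k + 1 ≤ i) (a : P i),
        c (j k ⟨i, Nat.le_of_succ_le h⟩ a) = j (k + 1) ⟨i, h⟩ a := by
  have hf : ∃ f : ∀ i : {i : ℕ // k ≤ i}, P i →⋆ₙₐ[ℂ] B (k + 1),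
      f ⟨k, le_rfl⟩ = (j (k + 1) ⟨k + 1, le_rfl⟩).comp (γ k) ∧
      ∀ (i : ℕ) (h : k + 1 ≤ i), f ⟨i, Nat.le_of_succ_le h⟩ = j (k + 1) ⟨i, h⟩ := by
    refine ⟨fun i => if h : k + 1 ≤ i.1 then j (k + 1) ⟨i.1, h⟩ else
      have hi : k = i.1 := le_antisymm i.2 (Nat.le_of_not_lt h)
      hi ▸ (j (k + 1) ⟨k + 1, le_rfl⟩).comp (γ k), ?_, fun i h => dif_pos h⟩
    exact dif_neg (Nat.not_succ_le_self k)
  obtain ⟨f, hf₀, hf₁⟩ := hf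
  obtain ⟨c, hc⟩ := (hj k).exists_desc _ f
  exact ⟨c, fun a => by rw [hc, hf₀]; rfl, fun i h a => by rw [hc, hf₁ i h]⟩

variable {c : ∀ k, B k →⋆ₙₐ[ℂ] B (k + 1)}

theorem telescope_conn_surjective (hj : ∀ k, IsCStarCoproduct (j k))
    (hc₁ : ∀ (k i : ℕ) (h : k + 1 ≤ i) (a : P i),
      c k (j k ⟨i, Nat.le_of_succ_le h⟩ a) = j (k + 1) ⟨i, h⟩ a) (k : ℕ) :
    Function.Surjective (c k) := by
  obtain ⟨s, hs⟩ := (hj (k + 1)).exists_desc _ fun i => j k ⟨i.1, Nat.le_of_succ_le i.2⟩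
  have hcs : (c k).comp s = NonUnitalStarAlgHom.id ℂ _ :=
    (hj (k + 1)).hom_ext fun i a => by
      change c k (s (j (k + 1) i a)) = j (k + 1) i a
      rw [hs, hc₁ k i.1 i.2]
  exact fun b => ⟨s b, DFunLike.congr_fun hcs b⟩

/-- A dense set of elements of the coproduct of a tail is eventually pushed into the first
factor. -/
theorem exists_iterHom_telescope_close (hj : ∀ k, IsCStarCoproduct (j k))
    (hc₀ : ∀ k a, c k (j k ⟨k, le_rfl⟩ a) = j (k + 1) ⟨k + 1, le_rfl⟩ (γ k a))
    (hc₁ : ∀ (k i : ℕ) (h : k + 1 ≤ i) (a : P i),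
      c k (j k ⟨i, Nat.le_of_succ_le h⟩ a) = j (k + 1) ⟨i, h⟩ a)
    (k : ℕ) (b : B k) {ε : ℝ} (hε : 0 < ε) :
    ∃ b' : B k, ‖b - b'‖ < ε ∧
      ∃ n, ∃ p : P (k + n), iterHom c k n b' = j (k + n) ⟨k + n, le_rfl⟩ p := by
  let good (n : ℕ) (x : B k) : Prop := ∃ p : P (k + n), iterHom c k n x = j (k + n) ⟨k + n, le_rfl⟩ p
  have good_mono : ∀ x, Monotone fun n => good n x := fun x =>
    monotone_nat_of_le_succ fun n ⟨p, hp⟩ =>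
      ⟨γ (k + n) p, (congrArg (c (k + n)) hp).trans (hc₀ (k + n) p)⟩
  have good₂ : ∀ {x y}, (∃ n, good n x) → (∃ n, good n y) → ∃ n, good n x ∧ good n y :=
    fun ⟨m, hm⟩ ⟨n, hn⟩ =>
      ⟨max m n, good_mono _ (le_max_left m n) hm, good_mono _ (le_max_right m n) hn⟩
  let S : NonUnitalStarSubalgebra ℂ (B k) :=
    { carrier := {x | ∃ n, good n x}
      zero_mem' := ⟨0, 0, by simp⟩
      add_mem' := fun hx hy => by
        obtain ⟨n, ⟨p, hp⟩, q, hq⟩ := good₂ hx hy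
        exact ⟨n, p + q, by rw [map_add, map_add, hp, hq]⟩
      mul_mem' := fun hx hy => by
        obtain ⟨n, ⟨p, hp⟩, q, hq⟩ := good₂ hx hy
        exact ⟨n, p * q, by rw [map_mul, map_mul, hp, hq]⟩
      smul_mem' := fun z x ⟨n, p, hp⟩ => ⟨n, z • p, by rw [map_smul, map_smul, hp]⟩
      star_mem' := fun ⟨n, p, hp⟩ => ⟨n, star p, by rw [map_star, map_star, hp]⟩ }
  have iter_gen : ∀ (n i : ℕ) (h : k + n ≤ i) (a : P i),
      iterHom c k n (j k ⟨i, Nat.le_of_add_right_le h⟩ a) = j (k + n) ⟨i, h⟩ a := by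
    intro n
    induction n with
    | zero => intro i h a; rfl
    | succ n ih =>
      intro i h a
      exact (congrArg (c (k + n)) (ih i (Nat.le_of_succ_le h) a)).trans (hc₁ (k + n) i h a)
  have gen_mem : ∀ i a, j k i a ∈ S := by
    rintro ⟨i, hi⟩ a
    obtain ⟨n, rfl⟩ := Nat.exists_eq_add_of_le (show k ≤ i from hi)
    exact ⟨n, a, iter_gen n (k + n) le_rfl a⟩
  have hb : b ∈ S.topologicalClosure :=
    (hj k).generates _ S.isClosed_topologicalClosure
      (fun i a => S.le_topologicalClosure (gen_mem i a)) b
  obtain ⟨b', hb', hlt⟩ := Metric.mem_closure_iff.1 hb ε hε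
  exact ⟨b', by rwa [← dist_eq_norm], hb'⟩

/-- The coproducts of the tails of an inductive system have the same inductive limit. -/
theorem isInductiveLimit_telescope (hj : ∀ k, IsCStarCoproduct (j k))
    (hc₀ : ∀ k a, c k (j k ⟨k, le_rfl⟩ a) = j (k + 1) ⟨k + 1, le_rfl⟩ (γ k a))
    (hc₁ : ∀ (k i : ℕ) (h : k + 1 ≤ i) (a : P i),
      c k (j k ⟨i, Nat.le_of_succ_le h⟩ a) = j (k + 1) ⟨i, h⟩ a)
    {L : Type u} [NonUnitalCStarAlgebra L] {μ : ∀ k, P k →⋆ₙₐ[ℂ] L}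
    (hμ : IsInductiveLimit γ L μ) {ν : ∀ k, B k →⋆ₙₐ[ℂ] L}
    (hν : ∀ k i a, ν k (j k i a) = μ i a) : IsInductiveLimit c L ν := by
  have hcompat : ∀ k, (ν (k + 1)).comp (c k) = ν k := by
    refine fun k => (hj k).hom_ext ?_
    rintro ⟨i, hi⟩ a
    change ν (k + 1) (c k (j k ⟨i, hi⟩ a)) = ν k (j k ⟨i, hi⟩ a)
    rcases eq_or_lt_of_le (show k ≤ i from hi) with rfl | h
    · rw [hc₀, hν, hν]
      exact DFunLike.congr_fun (hμ.compat k) a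
    · rw [hc₁ k i h, hν, hν]
  refine .of_norm_lt hcompat ?_ fun k b ε hε => ?_
  · refine hμ.dense_union.mono (Set.iUnion_mono fun k => ?_)
    rintro _ ⟨a, rfl⟩
    exact ⟨j k ⟨k, le_rfl⟩ a, hν k ⟨k, le_rfl⟩ a⟩
  · obtain ⟨b', hbb', n, p, hp⟩ :=
      exists_iterHom_telescope_close hj hc₀ hc₁ k b (ε := ε / 3) (by positivity)
    have iter_first : ∀ m, iterHom c (k + n) m (j (k + n) ⟨k + n, le_rfl⟩ p) =
        j (k + n + m) ⟨k + n + m, le_rfl⟩ (iterHom γ (k + n) m p) := by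
      intro m
      induction m with
      | zero => rfl
      | succ m ih => exact (congrArg (c (k + n + m)) ih).trans (hc₀ (k + n + m) _)
    have hlim : ‖μ (k + n) p‖ < ‖μ (k + n) p‖ + ε / 3 := by linarith
    obtain ⟨m, hm⟩ := ((hμ.norm_tendsto (k + n) p).eventually_lt_const hlim).exists
    refine ⟨n + m, ?_⟩
    have hνp : μ (k + n) p = ν k b' := by
      rw [← hν (k + n) ⟨k + n, le_rfl⟩ p, ← hp, map_iterHom hcompat]
    have h₁ : ‖iterHom c k (n + m) b'‖ ≤ ‖iterHom γ (k + n) m p‖ := by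
      rw [← norm_iterHom_iterHom, hp, iter_first]
      exact NonUnitalStarAlgHom.norm_apply_le _ _
    have h₂ : ‖iterHom c k (n + m) b‖ ≤ ‖iterHom c k (n + m) b'‖ + ‖b - b'‖ := by
      have := NonUnitalStarAlgHom.norm_apply_le (iterHom c k (n + m)) (b - b')
      rw [map_sub] at this
      linarith [norm_le_norm_add_norm_sub' (iterHom c k (n + m) b) (iterHom c k (n + m) b')]
    have h₃ : ‖ν k b'‖ ≤ ‖ν k b‖ + ‖b - b'‖ := by
      have := NonUnitalStarAlgHom.norm_apply_le (ν k) (b - b')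
      rw [map_sub] at this
      linarith [norm_le_norm_add_norm_sub (ν k b) (ν k b')]
    rw [hνp] at hm
    linarith

end Telescope

end

open TopologicalSpace in
/-- A separable C*-algebra of trivial shape (i.e. an inductive limit of projective
C*-algebras) is an inductive limit of projective C*-algebras with surjective connecting
morphisms. -/
theorem trivialShape_implies_surjective_limit_of_projectives
    (A : Type u) [NonUnitalCStarAlgebra A] [SeparableSpace A]
    (hA : IsInductiveLimitOfProjectives A) :
    ∃ (S : CStarInductiveSystem.{u}) (ν : ∀ k, S.X k →⋆ₙₐ[ℂ] A),
      IsInductiveLimit S.conn A ν ∧ (∀ k, IsProjective (S.X k)) ∧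
      ∀ k, Function.Surjective (S.conn k) := by
  obtain ⟨S, μ, hμ, hS⟩ := hA
  choose B instB j hj using fun k => exists_isCStarCoproduct fun i : {i : ℕ // k ≤ i} => S.X i
  choose c hc₀ hc₁ using exists_telescope_conn (γ := S.conn) hj
  choose ν hν using fun k => (hj k).exists_desc A fun i => μ i.1
  exact ⟨⟨B, instB, c⟩, ν, isInductiveLimit_telescope hj hc₀ hc₁ hμ hν,
    fun k => (hj k).isProjective fun i => hS i.1, telescope_conn_surjective hj hc₁⟩
end

section
/- Let A be a separable C*-algebra that is semiprojective and isomorphic to the inductive limit of an inductive system of projective C*-algebras (equivalently, A is semiprojective with trivial shape). Then A is projective. -/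
open Filter Topology Set

noncomputable section

namespace InductiveLimitLifting

open scoped BoundedContinuousFunction CStarAlgebra

section Truncation

variable {A C : Type*} [NonUnitalCStarAlgebra A] [NonUnitalCStarAlgebra C]

/-- Replace the first `k` entries of a bounded sequence by zero. -/
def truncSeq (k : ℕ) (c : ℕ →ᵇ C) : ℕ →ᵇ C :=
  BoundedContinuousFunction.ofNormedAddCommGroup (fun n => if n < k then 0 else c n)
    continuous_of_discreteTopology ‖c‖ fun n => by
      split_ifs
      · simp
      · exact c.norm_coe_le_norm n

@[simp]
theorem truncSeq_apply (k : ℕ) (c : ℕ →ᵇ C) (n : ℕ) :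
    truncSeq k c n = if n < k then 0 else c n := rfl

/-- Truncation of the sequence in a pair consisting of a bounded sequence and an element,
as a *-homomorphism. -/
def truncHom (k : ℕ) : ((ℕ →ᵇ C) × A) →⋆ₙₐ[ℂ] ((ℕ →ᵇ C) × A) where
  toFun p := (truncSeq k p.1, p.2)
  map_smul' r p := by
    ext n
    · by_cases h : n < k <;> simp [h]
    · rfl
  map_zero' := by
    ext n
    · simp
    · rfl
  map_add' p q := by
    ext n
    · by_cases h : n < k <;> simp [h]
    · rfl
  map_mul' p q := by
    ext n
    · by_cases h : n < k <;> simp [h]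
    · rfl
  map_star' p := by
    ext n
    · by_cases h : n < k <;> simp [h]
    · rfl

@[simp]
theorem truncHom_fst (k : ℕ) (p : (ℕ →ᵇ C) × A) : (truncHom k p).1 = truncSeq k p.1 := rfl

@[simp]
theorem truncHom_snd (k : ℕ) (p : (ℕ →ᵇ C) × A) : (truncHom k p).2 = p.2 := rfl

end Truncation

section Threads

variable {P : ℕ → Type*} [∀ k, NonUnitalCStarAlgebra (P k)]
  {γ : ∀ k, P k →⋆ₙₐ[ℂ] P (k + 1)} {A C D : Type*} [NonUnitalCStarAlgebra A]
  [NonUnitalCStarAlgebra C] [NonUnitalCStarAlgebra D] {μ : ∀ k, P k →⋆ₙₐ[ℂ] A}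
  {ψ : ∀ k, P k →⋆ₙₐ[ℂ] C}

/-- Pairs `(c, a)` for which some eventually coherent thread of the system `(P, γ)` represents
`a` in the limit and eventually has image `c` under the maps `ψ k`. -/
def threadSubalgebra (γ : ∀ k, P k →⋆ₙₐ[ℂ] P (k + 1)) (μ : ∀ k, P k →⋆ₙₐ[ℂ] A)
    (ψ : ∀ k, P k →⋆ₙₐ[ℂ] C) : NonUnitalStarSubalgebra ℂ ((ℕ →ᵇ C) × A) where
  carrier := {p | ∃ (x : ∀ n, P n) (N : ℕ), ∀ n, N ≤ n →
    x (n + 1) = γ n (x n) ∧ μ n (x n) = p.2 ∧ ψ n (x n) = p.1 n}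
  add_mem' := by
    rintro p q ⟨x, N, hx⟩ ⟨y, M, hy⟩
    refine ⟨x + y, max N M, fun n hn => ?_⟩
    obtain ⟨h1, h2, h3⟩ := hx n (le_of_max_le_left hn)
    obtain ⟨k1, k2, k3⟩ := hy n (le_of_max_le_right hn)
    simp [h1, h2, h3, k1, k2, k3]
  zero_mem' := ⟨0, 0, fun n _ => by simp⟩
  mul_mem' := by
    rintro p q ⟨x, N, hx⟩ ⟨y, M, hy⟩
    refine ⟨x * y, max N M, fun n hn => ?_⟩
    obtain ⟨h1, h2, h3⟩ := hx n (le_of_max_le_left hn)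
    obtain ⟨k1, k2, k3⟩ := hy n (le_of_max_le_right hn)
    simp [h1, h2, h3, k1, k2, k3]
  smul_mem' := by
    rintro r p ⟨x, N, hx⟩
    refine ⟨r • x, N, fun n hn => ?_⟩
    obtain ⟨h1, h2, h3⟩ := hx n hn
    simp [h1, h2, h3, map_smul]
  star_mem' := by
    rintro p ⟨x, N, hx⟩
    refine ⟨star x, N, fun n hn => ?_⟩
    obtain ⟨h1, h2, h3⟩ := hx n hn
    simp [h1, h2, h3, map_star]

theorem mem_threadSubalgebra_of_eventuallyEq {p q : (ℕ →ᵇ C) × A}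
    (hp : p ∈ threadSubalgebra γ μ ψ) (h2 : p.2 = q.2) {k : ℕ}
    (h1 : ∀ n, k ≤ n → p.1 n = q.1 n) : q ∈ threadSubalgebra γ μ ψ := by
  obtain ⟨x, N, hx⟩ := hp
  refine ⟨x, max N k, fun n hn => ?_⟩
  rw [← h2, ← h1 n (le_of_max_le_right hn)]
  exact hx n (le_of_max_le_left hn)

theorem eq_iterHom_of_coherent {x : ∀ n, P n} {N : ℕ}
    (hx : ∀ n, N ≤ n → x (n + 1) = γ n (x n)) (m : ℕ) :
    x (N + m) = iterHom γ N m (x N) := by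
  induction m with
  | zero => rfl
  | succ m ih =>
    have h := hx (N + m) (Nat.le_add_right _ _)
    rw [ih] at h
    exact h

/-- Every element of a term of an inductive system starts a coherent thread. -/
theorem exists_thread (γ : ∀ k, P k →⋆ₙₐ[ℂ] P (k + 1)) (j : ℕ) (y : P j) :
    ∃ x : ∀ n, P n, x j = y ∧ ∀ n, j ≤ n → x (n + 1) = γ n (x n) := by
  refine ⟨fun n => if h : j ≤ n then Nat.leRecOn h (fun {k} => γ k) y else 0, ?_, ?_⟩
  · simp [Nat.leRecOn_self]
  · intro n hn
    simp [hn, Nat.le_succ_of_le hn, Nat.leRecOn_succ hn]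

theorem eventually_norm_fst_le (L : IsInductiveLimit γ A μ) {p : (ℕ →ᵇ C) × A}
    (hp : p ∈ (threadSubalgebra γ μ ψ).topologicalClosure) {ε : ℝ} (hε : 0 < ε) :
    ∀ᶠ n in atTop, ‖p.1 n‖ ≤ ‖p.2‖ + ε := by
  have hp' : p ∈ closure (threadSubalgebra γ μ ψ : Set ((ℕ →ᵇ C) × A)) := hp
  obtain ⟨q, ⟨x, N, hx⟩, hq⟩ := Metric.mem_closure_iff.1 hp' (ε / 3) (by positivity)
  rw [dist_eq_norm] at hq
  have hq1 : ‖p.1 - q.1‖ ≤ ‖p - q‖ := norm_fst_le (p - q)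
  have hq2 : ‖p.2 - q.2‖ ≤ ‖p - q‖ := norm_snd_le (p - q)
  have hlim := L.norm_tendsto N (x N)
  rw [(hx N le_rfl).2.1] at hlim
  have hev := hlim.eventually_le_const (show ‖q.2‖ < ‖q.2‖ + ε / 3 by linarith)
  obtain ⟨M, hM⟩ := eventually_atTop.1 hev
  refine eventually_atTop.2 ⟨N + M, fun n hn => ?_⟩
  obtain ⟨m, rfl⟩ : ∃ m, n = N + m := ⟨n - N, by omega⟩
  have h1 : ‖q.1 (N + m)‖ ≤ ‖q.2‖ + ε / 3 := by
    rw [← (hx (N + m) (Nat.le_add_right _ _)).2.2]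
    refine (NonUnitalStarAlgHom.norm_apply_le _ _).trans ?_
    rw [eq_iterHom_of_coherent fun n hn => (hx n hn).1]
    exact hM m (by omega)
  have h2 : ‖p.1 (N + m) - q.1 (N + m)‖ ≤ ‖p.1 - q.1‖ := (p.1 - q.1).norm_coe_le_norm (N + m)
  have h3 := norm_le_norm_add_norm_sub' (p.1 (N + m)) (q.1 (N + m))
  have h4 := norm_le_norm_add_norm_sub' q.2 p.2
  rw [norm_sub_rev] at h4
  linarith

/-- Pairs `(c, a)` in the closure of the thread algebra such that `c` vanishes before `k` and is
an exact lift of `σ a` along `π` from `k` on. -/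
def liftSubalgebra (γ : ∀ k, P k →⋆ₙₐ[ℂ] P (k + 1)) (μ : ∀ k, P k →⋆ₙₐ[ℂ] A)
    (ψ : ∀ k, P k →⋆ₙₐ[ℂ] C) (π : C →⋆ₙₐ[ℂ] D) (σ : A →⋆ₙₐ[ℂ] D) (k : ℕ) :
    NonUnitalStarSubalgebra ℂ ((ℕ →ᵇ C) × A) where
  carrier := {p | p ∈ (threadSubalgebra γ μ ψ).topologicalClosure ∧
    (∀ n, n < k → p.1 n = 0) ∧ ∀ n, k ≤ n → π (p.1 n) = σ p.2}
  add_mem' := by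
    rintro p q ⟨hp, hp1, hp2⟩ ⟨hq, hq1, hq2⟩
    exact ⟨add_mem hp hq, fun n hn => by simp [hp1 n hn, hq1 n hn],
      fun n hn => by simp [hp2 n hn, hq2 n hn]⟩
  zero_mem' := ⟨zero_mem _, fun n _ => by simp, fun n _ => by simp⟩
  mul_mem' := by
    rintro p q ⟨hp, hp1, hp2⟩ ⟨hq, hq1, hq2⟩
    exact ⟨mul_mem hp hq, fun n hn => by simp [hp1 n hn],
      fun n hn => by simp [hp2 n hn, hq2 n hn]⟩
  smul_mem' := by
    rintro r p ⟨hp, hp1, hp2⟩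
    exact ⟨SMulMemClass.smul_mem r hp, fun n hn => by simp [hp1 n hn],
      fun n hn => by simp [hp2 n hn, map_smul]⟩
  star_mem' := by
    rintro p ⟨hp, hp1, hp2⟩
    exact ⟨star_mem hp, fun n hn => by simp [hp1 n hn],
      fun n hn => by simp [hp2 n hn, map_star]⟩

variable {π : C →⋆ₙₐ[ℂ] D} {σ : A →⋆ₙₐ[ℂ] D}

instance isClosed_liftSubalgebra (k : ℕ) :
    IsClosed (liftSubalgebra γ μ ψ π σ k : Set ((ℕ →ᵇ C) × A)) := by
  have hπ : Continuous π := map_continuous π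
  have hσ : Continuous σ := map_continuous σ
  have hev : ∀ n, Continuous fun p : (ℕ →ᵇ C) × A => p.1 n := fun n =>
    (BoundedContinuousFunction.lipschitz_eval_const n).continuous.comp continuous_fst
  have hzero : IsClosed {p : (ℕ →ᵇ C) × A | ∀ n, n < k → p.1 n = 0} := by
    simp only [ofPred_forall]
    exact isClosed_iInter fun n => isClosed_iInter fun _ =>
      isClosed_eq (hev n) continuous_const
  have hlift : IsClosed {p : (ℕ →ᵇ C) × A | ∀ n, k ≤ n → π (p.1 n) = σ p.2} := by
    simp only [ofPred_forall]
    exact isClosed_iInter fun n => isClosed_iInter fun _ =>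
      isClosed_eq (hπ.comp (hev n)) (hσ.comp continuous_snd)
  exact (NonUnitalStarSubalgebra.isClosed_topologicalClosure
    (threadSubalgebra γ μ ψ)).inter (hzero.inter hlift)

theorem truncHom_mem_topologicalClosure (k : ℕ) {p : (ℕ →ᵇ C) × A}
    (hp : p ∈ (threadSubalgebra γ μ ψ).topologicalClosure) :
    truncHom k p ∈ (threadSubalgebra γ μ ψ).topologicalClosure := by
  refine map_mem_closure (map_continuous (truncHom k)) hp fun q hq => ?_
  exact mem_threadSubalgebra_of_eventuallyEq hq rfl (k := k) fun n hn => by simp [hn.not_gt]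

theorem truncHom_mem_liftSubalgebra {k l : ℕ} (hkl : k ≤ l) {p : (ℕ →ᵇ C) × A}
    (hp : p ∈ liftSubalgebra γ μ ψ π σ k) : truncHom l p ∈ liftSubalgebra γ μ ψ π σ l :=
  ⟨truncHom_mem_topologicalClosure l hp.1, fun n hn => by simp [hn],
    fun n hn => by simpa [hn.not_gt] using hp.2.2 n (hkl.trans hn)⟩

/-- The connecting maps between consecutive lift algebras. -/
def liftConn (γ : ∀ k, P k →⋆ₙₐ[ℂ] P (k + 1)) (μ : ∀ k, P k →⋆ₙₐ[ℂ] A)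
    (ψ : ∀ k, P k →⋆ₙₐ[ℂ] C) (π : C →⋆ₙₐ[ℂ] D) (σ : A →⋆ₙₐ[ℂ] D) (k : ℕ) :
    liftSubalgebra γ μ ψ π σ k →⋆ₙₐ[ℂ] liftSubalgebra γ μ ψ π σ (k + 1) :=
  NonUnitalStarAlgHom.codRestrict
    ((truncHom (k + 1)).comp (NonUnitalStarSubalgebraClass.subtype (liftSubalgebra γ μ ψ π σ k)))
    _ fun p => truncHom_mem_liftSubalgebra k.le_succ p.2

@[simp]
theorem coe_liftConn (k : ℕ) (p : liftSubalgebra γ μ ψ π σ k) :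
    (liftConn γ μ ψ π σ k p : (ℕ →ᵇ C) × A) = truncHom (k + 1) p := rfl

/-- The projection of a lift algebra to the second coordinate. -/
def liftLimit (γ : ∀ k, P k →⋆ₙₐ[ℂ] P (k + 1)) (μ : ∀ k, P k →⋆ₙₐ[ℂ] A)
    (ψ : ∀ k, P k →⋆ₙₐ[ℂ] C) (π : C →⋆ₙₐ[ℂ] D) (σ : A →⋆ₙₐ[ℂ] D) (k : ℕ) :
    liftSubalgebra γ μ ψ π σ k →⋆ₙₐ[ℂ] A :=
  (NonUnitalStarAlgHom.snd ℂ (ℕ →ᵇ C) A).comp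
    (NonUnitalStarSubalgebraClass.subtype (liftSubalgebra γ μ ψ π σ k))

@[simp]
theorem liftLimit_apply (k : ℕ) (p : liftSubalgebra γ μ ψ π σ k) :
    liftLimit γ μ ψ π σ k p = (p : (ℕ →ᵇ C) × A).2 := rfl

theorem liftConn_surjective (hπ : Function.Surjective π) (k : ℕ) :
    Function.Surjective (liftConn γ μ ψ π σ k) := by
  rintro ⟨⟨c, a⟩, hmem, hzero, hlift⟩
  obtain ⟨d, hd⟩ := hπ (σ a)
  let e : ℕ →ᵇ C := BoundedContinuousFunction.ofNormedAddCommGroup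
    (fun n => if n = k then d else 0) continuous_of_discreteTopology ‖d‖
    fun n => by split_ifs <;> simp
  have he : ∀ n, e n = if n = k then d else 0 := fun n => rfl
  have hemem : ((e, 0) : (ℕ →ᵇ C) × A) ∈ (threadSubalgebra γ μ ψ).topologicalClosure :=
    NonUnitalStarSubalgebra.le_topologicalClosure _ <|
      mem_threadSubalgebra_of_eventuallyEq (zero_mem _) rfl (k := k + 1) fun n hn => by
        simp [he, show n ≠ k by omega]
  have hsum : ((c + e, a) : (ℕ →ᵇ C) × A) ∈ (threadSubalgebra γ μ ψ).topologicalClosure := by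
    simpa using add_mem hmem hemem
  refine ⟨⟨(c + e, a), hsum, fun n hn => ?_, fun n hn => ?_⟩, ?_⟩
  · have := hzero n (by omega)
    simp_all [show n ≠ k by omega]
  · rcases hn.eq_or_lt with rfl | hn
    · have := hzero k (by omega)
      simp_all
    · have := hlift n hn
      simp_all [show n ≠ k by omega]
  · refine Subtype.ext (Prod.ext (BoundedContinuousFunction.ext fun n => ?_) rfl)
    by_cases hn : n < k + 1
    · have := hzero n hn
      simp_all
    · simp [hn, he, show n ≠ k by omega]

theorem coe_iterHom_liftConn (k m : ℕ) (p : liftSubalgebra γ μ ψ π σ k) :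
    (iterHom (liftConn γ μ ψ π σ) k m p : (ℕ →ᵇ C) × A) = truncHom (k + m) p := by
  induction m with
  | zero =>
    refine Prod.ext (BoundedContinuousFunction.ext fun n => ?_) rfl
    change p.1.1 n = if n < k then 0 else p.1.1 n
    split_ifs with hn
    · exact p.2.2.1 n hn
    · rfl
  | succ m ih =>
    change truncHom (k + m + 1) (iterHom (liftConn γ μ ψ π σ) k m p : (ℕ →ᵇ C) × A) = _
    rw [ih]
    refine Prod.ext (BoundedContinuousFunction.ext fun n => ?_) rfl
    simp only [truncHom_fst, truncSeq_apply, ← add_assoc]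
    split_ifs <;> first | rfl | omega

theorem isInductiveLimit_liftSubalgebra (L : IsInductiveLimit γ A μ)
    (hψ : ∀ k, π.comp (ψ k) = σ.comp (μ k)) :
    IsInductiveLimit (liftConn γ μ ψ π σ) A (liftLimit γ μ ψ π σ) where
  compat k := rfl
  dense_union := by
    refine L.dense_union.mono (iUnion_mono fun j => ?_)
    rintro _ ⟨y, rfl⟩
    obtain ⟨x, rfl, hx⟩ := exists_thread γ j y
    have hμ : ∀ m, μ (j + m) (x (j + m)) = μ j (x j) := by
      intro m
      induction m with
      | zero => rfl
      | succ m ih =>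
        rw [← ih, ← add_assoc, hx _ (Nat.le_add_right _ _)]
        exact DFunLike.congr_fun (L.compat (j + m)) _
    have hnorm : ∀ m, ‖x (j + m)‖ ≤ ‖x j‖ := fun m => by
      rw [eq_iterHom_of_coherent hx]
      exact NonUnitalStarAlgHom.norm_apply_le _ _
    have hμ' : ∀ n, j ≤ n → μ n (x n) = μ j (x j) := fun n hn => by
      obtain ⟨m, rfl⟩ := Nat.exists_eq_add_of_le hn
      exact hμ m
    let c : ℕ →ᵇ C := BoundedContinuousFunction.ofNormedAddCommGroup
      (fun n => if n < j then 0 else ψ n (x n)) continuous_of_discreteTopology ‖x j‖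
      fun n => by
        split_ifs with hn
        · simp
        · obtain ⟨m, rfl⟩ := Nat.exists_eq_add_of_le (not_lt.1 hn)
          exact (NonUnitalStarAlgHom.norm_apply_le _ _).trans (hnorm m)
    have hc : ∀ n, c n = if n < j then 0 else ψ n (x n) := fun n => rfl
    refine ⟨⟨(c, μ j (x j)), ?_, fun n hn => by simp [hc, hn], fun n hn => ?_⟩, rfl⟩
    · refine NonUnitalStarSubalgebra.le_topologicalClosure _
        ⟨x, j, fun n hn => ⟨hx n hn, hμ' n hn, ?_⟩⟩
      simp [hc, hn.not_gt]
    · simp only [hc, hn.not_gt, if_false]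
      rw [← hμ' n hn]
      exact DFunLike.congr_fun (hψ n) (x n)
  norm_tendsto k p := by
    have hnorm : ∀ m, ‖iterHom (liftConn γ μ ψ π σ) k m p‖ =
        max ‖truncSeq (k + m) p.1.1‖ ‖p.1.2‖ := fun m => by
      change ‖(iterHom (liftConn γ μ ψ π σ) k m p : (ℕ →ᵇ C) × A)‖ = _
      rw [coe_iterHom_liftConn]
      rfl
    simp only [hnorm, liftLimit_apply]
    refine Metric.tendsto_atTop.2 fun ε hε => ?_
    obtain ⟨M, hM⟩ := eventually_atTop.1
      (eventually_norm_fst_le L p.2.1 (half_pos hε))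
    refine ⟨M, fun m hm => ?_⟩
    have hle : ‖truncSeq (k + m) p.1.1‖ ≤ ‖p.1.2‖ + ε / 2 := by
      refine (BoundedContinuousFunction.norm_le (by positivity)).2 fun n => ?_
      rw [truncSeq_apply]
      split_ifs with hn
      · rw [norm_zero]
        positivity
      · exact hM n (by omega)
    have h1 : max ‖truncSeq (k + m) p.1.1‖ ‖p.1.2‖ ≤ ‖p.1.2‖ + ε / 2 :=
      max_le hle (by linarith)
    have h2 := le_max_right ‖truncSeq (k + m) p.1.1‖ ‖p.1.2‖
    rw [Real.dist_eq, abs_of_nonneg (by linarith)]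
    linarith

end Threads

end InductiveLimitLifting

end

open TopologicalSpace in
/-- A separable semiprojective C*-algebra of trivial shape (i.e. an inductive limit of
projective C*-algebras) is projective. -/
theorem semiprojective_trivialShape_implies_projective
    (A : Type u) [NonUnitalCStarAlgebra A] [SeparableSpace A]
    (hsp : IsSemiprojective A) (hshape : IsInductiveLimitOfProjectives A) :
    IsProjective A := by
  obtain ⟨⟨P, _, γ⟩, μ, L, hP⟩ := hshape
  intro C D _ _ π hπ σ
  choose ψ hψ using fun k => hP k C D π hπ (σ.comp (μ k))
  obtain ⟨k, τ, hτ⟩ := hsp _ (InductiveLimitLifting.liftConn γ μ ψ π σ)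
    (InductiveLimitLifting.liftConn_surjective hπ) A _
    (InductiveLimitLifting.isInductiveLimit_liftSubalgebra L hψ) (NonUnitalStarAlgHom.id ℂ A)
  have hsnd : ∀ a, (τ a).1.2 = a := fun a => DFunLike.congr_fun hτ a
  have hlift : ∀ a, π ((τ a).1.1 k) = σ a := fun a => by
    rw [(τ a).2.2.2 k le_rfl, hsnd]
  refine ⟨{ toFun := fun a => (τ a).1.1 k
            map_smul' := fun r a => by simp [map_smul]
            map_zero' := by simp
            map_add' := fun a b => by simp
            map_mul' := fun a b => by simp
            map_star' := fun a => by simp [map_star] }, ?_⟩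
  ext a
  exact hlift a
end

section
/- Let A be a separable C*-algebra that is weakly semiprojective and isomorphic to the inductive limit of an inductive system of projective C*-algebras (equivalently, A is weakly semiprojective with trivial shape). Then A is weakly projective. -/
open Filter Topology Set

noncomputable section

namespace CStarInductiveSystem

variable (S : CStarInductiveSystem.{w})

instance : NonUnitalCStarAlgebra (lp S.X ⊤) where

/-- The evaluation of bounded sequences at an index. -/
def eval (j : ℕ) : lp S.X ⊤ →⋆ₙₐ[ℂ] S.X j where
  toFun a := a j
  map_smul' _ _ := rfl
  map_zero' := rfl
  map_add' _ _ := rfl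
  map_mul' _ _ := rfl
  map_star' _ := rfl

/-- Replacing the entries of a bounded sequence before the index `k` by zero. -/
def truncate (k : ℕ) : lp S.X ⊤ →⋆ₙₐ[ℂ] lp S.X ⊤ where
  toFun a := ⟨fun j => if k ≤ j then a j else 0, by
    refine memℓp_infty ⟨‖a‖, ?_⟩
    rintro _ ⟨j, rfl⟩
    dsimp only
    split_ifs
    · exact lp.norm_apply_le_norm ENNReal.top_ne_zero a j
    · simp⟩
  map_smul' c a := by ext j; by_cases h : k ≤ j <;> simp [h]
  map_zero' := by ext j; simp
  map_add' a b := by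
    ext j
    change (if k ≤ j then a j + b j else 0) = (if k ≤ j then a j else 0) + if k ≤ j then b j else 0
    by_cases h : k ≤ j <;> simp [h]
  map_mul' a b := by ext j; by_cases h : k ≤ j <;> simp [h, lp.infty_coeFn_mul]
  map_star' a := by ext j; by_cases h : k ≤ j <;> simp [h]

lemma truncate_apply (k j : ℕ) (a : lp S.X ⊤) :
    S.truncate k a j = if k ≤ j then a j else 0 := rfl

lemma truncate_truncate {k m : ℕ} (h : k ≤ m) (a : lp S.X ⊤) :
    S.truncate m (S.truncate k a) = S.truncate m a := by
  ext j
  by_cases hj : m ≤ j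
  · simp [truncate_apply, hj, h.trans hj]
  · simp [truncate_apply, hj]

lemma truncate_truncate_of_ge {k m : ℕ} (h : k ≤ m) (a : lp S.X ⊤) :
    S.truncate k (S.truncate m a) = S.truncate m a := by
  ext j
  by_cases hj : m ≤ j
  · simp [truncate_apply, hj, h.trans hj]
  · simp [truncate_apply, hj]

/-- The sequence starting with `x` at index `m`, zero before `m`, and following the connecting
morphisms after `m`. -/
def orbit (m : ℕ) (x : S.X m) : ∀ j, S.X j
  | 0 => if h : m = 0 then h ▸ x else 0
  | j + 1 => if h : m = j + 1 then h ▸ x else S.conn j (orbit m x j)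

lemma orbit_self (m : ℕ) (x : S.X m) : S.orbit m x m = x := by
  cases m <;> simp [orbit]

lemma orbit_of_lt {m j : ℕ} (x : S.X m) (h : j < m) : S.orbit m x j = 0 := by
  induction j with
  | zero => simp [orbit, h.ne']
  | succ j ih => simp [orbit, h.ne', ih (by omega)]

lemma orbit_succ {m j : ℕ} (x : S.X m) (h : m ≤ j) :
    S.orbit m x (j + 1) = S.conn j (S.orbit m x j) := by
  simp [orbit, show m ≠ j + 1 by omega]

lemma norm_orbit_le (m : ℕ) (x : S.X m) (j : ℕ) : ‖S.orbit m x j‖ ≤ ‖x‖ := by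
  rcases lt_or_ge j m with h | h
  · simp [S.orbit_of_lt x h]
  · induction j, h using Nat.le_induction with
    | base => simp [orbit_self]
    | succ j h ih =>
      rw [S.orbit_succ x h]
      exact (NonUnitalStarAlgHom.norm_apply_le _ _).trans ih

/-- The orbit of `x` as a bounded sequence. -/
def boundedOrbit (m : ℕ) (x : S.X m) : lp S.X ⊤ :=
  ⟨S.orbit m x, memℓp_infty ⟨‖x‖, by rintro _ ⟨j, rfl⟩; exact S.norm_orbit_le m x j⟩⟩

open scoped CStarAlgebra

variable {A : Type w} [NonUnitalCStarAlgebra A] (μ : ∀ k, S.X k →⋆ₙₐ[ℂ] A)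

/-- Pairs of a bounded sequence which eventually follows the connecting morphisms and its
image in the limit algebra. -/
def coherent : NonUnitalStarSubalgebra ℂ (lp S.X ⊤ × A) where
  carrier := {p | ∀ᶠ j in atTop, μ j (p.1 j) = p.2 ∧ p.1 (j + 1) = S.conn j (p.1 j)}
  add_mem' {p q} hp hq := by
    filter_upwards [hp, hq] with j h₁ h₂
    simp [h₁.1, h₂.1, h₁.2, h₂.2]
  zero_mem' := by simp
  mul_mem' {p q} hp hq := by
    filter_upwards [hp, hq] with j h₁ h₂
    simp [h₁.1, h₂.1, h₁.2, h₂.2, lp.infty_coeFn_mul]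
  smul_mem' c p hp := by
    filter_upwards [hp] with j h
    simp [h.1, h.2]
  star_mem' {p} hp := by
    filter_upwards [hp] with j h
    simp [h.1, h.2, map_star]

/-- The truncation of the sequence component of a pair. -/
def truncateProd (A : Type w) [NonUnitalCStarAlgebra A] (k : ℕ) :
    lp S.X ⊤ × A →⋆ₙₐ[ℂ] lp S.X ⊤ × A :=
  ((S.truncate k).comp (NonUnitalStarAlgHom.fst ℂ _ _)).prod (NonUnitalStarAlgHom.snd ℂ _ _)

@[simp] lemma truncateProd_apply (k : ℕ) (p : lp S.X ⊤ × A) :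
    S.truncateProd A k p = (S.truncate k p.1, p.2) := rfl

/-- The C*-algebra of pairs in the closure of the coherent ones whose sequence vanishes before
the index `k`. -/
def tail (k : ℕ) : NonUnitalStarSubalgebra ℂ (lp S.X ⊤ × A) :=
  (S.coherent μ).topologicalClosure ⊓
    NonUnitalStarAlgHom.equalizer (S.truncateProd A k) (NonUnitalStarAlgHom.id ℂ _)

lemma mem_tail {k : ℕ} {p : lp S.X ⊤ × A} :
    p ∈ S.tail μ k ↔ p ∈ (S.coherent μ).topologicalClosure ∧ S.truncate k p.1 = p.1 := by
  refine and_congr Iff.rfl ?_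
  change S.truncateProd A k p = p ↔ _
  simp [Prod.ext_iff]

lemma isClosed_tail (k : ℕ) : IsClosed (S.tail μ k : Set (lp S.X ⊤ × A)) :=
  ((S.coherent μ).isClosed_topologicalClosure).inter
    (isClosed_eq (map_continuous (S.truncateProd A k)) continuous_id)

instance (k : ℕ) : NonUnitalCStarAlgebra (S.tail μ k) :=
  NonUnitalStarSubalgebra.nonUnitalCStarAlgebra _ (h_closed := S.isClosed_tail μ k)

lemma truncateProd_mem_closure (k : ℕ) {p : lp S.X ⊤ × A}
    (hp : p ∈ (S.coherent μ).topologicalClosure) :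
    S.truncateProd A k p ∈ (S.coherent μ).topologicalClosure := by
  refine map_mem_closure (map_continuous (S.truncateProd A k)) hp fun q hq => ?_
  have hq' : ∀ᶠ j in atTop, μ j (q.1 j) = q.2 ∧ q.1 (j + 1) = S.conn j (q.1 j) := hq
  change ∀ᶠ j in atTop, _
  filter_upwards [hq', eventually_ge_atTop k] with j h hj
  simpa [truncate_apply, hj, hj.trans j.le_succ] using h

/-- The truncation morphism between consecutive tail algebras. -/
def tailConn (k : ℕ) : S.tail μ k →⋆ₙₐ[ℂ] S.tail μ (k + 1) :=
  NonUnitalStarAlgHom.codRestrict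
    ((S.truncateProd A (k + 1)).comp (NonUnitalStarSubalgebraClass.subtype (S.tail μ k))) _
    fun p => (S.mem_tail μ).2
      ⟨S.truncateProd_mem_closure μ (k + 1) ((S.mem_tail μ).1 p.2).1,
        S.truncate_truncate le_rfl _⟩

lemma tailConn_coe (k : ℕ) (p : S.tail μ k) :
    (S.tailConn μ k p : lp S.X ⊤ × A) = (S.truncate (k + 1) p.1.1, p.1.2) := rfl

lemma tailConn_surjective (k : ℕ) : Function.Surjective (S.tailConn μ k) := by
  intro p
  obtain ⟨h₁, h₂⟩ := (S.mem_tail μ).1 p.2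
  refine ⟨⟨p.1, (S.mem_tail μ).2 ⟨h₁, ?_⟩⟩, Subtype.ext (Prod.ext h₂ rfl)⟩
  rw [← h₂, S.truncate_truncate_of_ge k.le_succ]

lemma iterHom_tailConn_coe (k n : ℕ) (p : S.tail μ k) :
    (iterHom (S.tailConn μ) k n p : lp S.X ⊤ × A) = (S.truncate (k + n) p.1.1, p.1.2) := by
  induction n with
  | zero => exact Prod.ext ((S.mem_tail μ).1 p.2).2.symm rfl
  | succ n ih =>
    change (S.tailConn μ (k + n) (iterHom (S.tailConn μ) k n p) : lp S.X ⊤ × A) = _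
    rw [tailConn_coe, ih]
    exact Prod.ext (S.truncate_truncate (k + n).le_succ _) rfl

/-- The morphism from a tail algebra to the limit algebra. -/
def tailLimit (k : ℕ) : S.tail μ k →⋆ₙₐ[ℂ] A :=
  (NonUnitalStarAlgHom.snd ℂ (lp S.X ⊤) A).comp
    (NonUnitalStarSubalgebraClass.subtype (S.tail μ k))

lemma tailLimit_apply (k : ℕ) (p : S.tail μ k) : S.tailLimit μ k p = p.1.2 := rfl

variable {S μ}

lemma _root_.IsInductiveLimit.apply_iterHom (h : IsInductiveLimit S.conn A μ) (k n : ℕ)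
    (x : S.X k) : μ (k + n) (iterHom S.conn k n x) = μ k x := by
  induction n with
  | zero => rfl
  | succ n ih =>
    rw [← ih]
    exact DFunLike.congr_fun (h.compat (k + n)) _

lemma tendsto_norm_of_mem_coherent (h : IsInductiveLimit S.conn A μ) {p : lp S.X ⊤ × A}
    (hp : p ∈ S.coherent μ) : Tendsto (fun j => ‖p.1 j‖) atTop (𝓝 ‖p.2‖) := by
  obtain ⟨J, hJ⟩ := eventually_atTop.1
    (show ∀ᶠ j in atTop, μ j (p.1 j) = p.2 ∧ p.1 (j + 1) = S.conn j (p.1 j) from hp)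
  have hiter : ∀ n, iterHom S.conn J n (p.1 J) = p.1 (J + n) := by
    intro n
    induction n with
    | zero => rfl
    | succ n ih =>
      change S.conn (J + n) (iterHom S.conn J n (p.1 J)) = _
      rw [ih]
      exact (hJ (J + n) (by omega)).2.symm
  have := h.norm_tendsto J (p.1 J)
  rw [(hJ J le_rfl).1] at this
  refine (tendsto_add_atTop_iff_nat J).1 (this.congr fun n => ?_)
  rw [hiter, add_comm]

lemma eventually_norm_lt_of_mem_closure (h : IsInductiveLimit S.conn A μ) {p : lp S.X ⊤ × A}
    (hp : p ∈ (S.coherent μ).topologicalClosure) {ε : ℝ} (hε : 0 < ε) :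
    ∀ᶠ j in atTop, ‖p.1 j‖ < ‖p.2‖ + ε ∧ ‖μ j (p.1 j) - p.2‖ < ε := by
  obtain ⟨q, hq, hpq⟩ := Metric.mem_closure_iff.1
    (show p ∈ closure (S.coherent μ : Set (lp S.X ⊤ × A)) from hp) (ε / 3) (by positivity)
  rw [dist_eq_norm] at hpq
  have h₁ : ‖p.1 - q.1‖ < ε / 3 := (norm_fst_le (p - q)).trans_lt hpq
  have h₂ : ‖p.2 - q.2‖ < ε / 3 := (norm_snd_le (p - q)).trans_lt hpq
  have hq' : ∀ᶠ j in atTop, μ j (q.1 j) = q.2 ∧ q.1 (j + 1) = S.conn j (q.1 j) := hq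
  filter_upwards [hq', (tendsto_norm_of_mem_coherent h hq).eventually_lt_const
    (show ‖q.2‖ < ‖q.2‖ + ε / 3 by linarith)] with j hj hnorm
  have h₃ : ‖p.1 j - q.1 j‖ < ε / 3 :=
    (lp.norm_apply_le_norm ENNReal.top_ne_zero (p.1 - q.1) j).trans_lt h₁
  constructor
  · have h₄ := norm_le_norm_add_norm_sub' (p.1 j) (q.1 j)
    have h₅ := norm_le_norm_add_norm_sub p.2 q.2
    linarith
  · calc ‖μ j (p.1 j) - p.2‖ = ‖μ j (p.1 j - q.1 j) - (p.2 - q.2)‖ := by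
          rw [map_sub, hj.1, sub_sub_sub_cancel_right]
      _ ≤ ‖μ j (p.1 j - q.1 j)‖ + ‖p.2 - q.2‖ := norm_sub_le _ _
      _ < ε := by
        have := NonUnitalStarAlgHom.norm_apply_le (μ j) (p.1 j - q.1 j)
        linarith

lemma boundedOrbit_mem_tail (h : IsInductiveLimit S.conn A μ) {k m : ℕ} (hkm : k ≤ m)
    (x : S.X m) : (S.boundedOrbit m x, μ m x) ∈ S.tail μ k := by
  refine (S.mem_tail μ).2 ⟨(S.coherent μ).le_topologicalClosure ?_, ?_⟩
  · change ∀ᶠ j in atTop, μ j (S.orbit m x j) = μ m x ∧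
      S.orbit m x (j + 1) = S.conn j (S.orbit m x j)
    filter_upwards [eventually_ge_atTop m] with j hj
    refine ⟨?_, S.orbit_succ x hj⟩
    induction j, hj using Nat.le_induction with
    | base => rw [orbit_self]
    | succ j hj ih =>
      rw [← ih, S.orbit_succ x hj]
      exact DFunLike.congr_fun (h.compat j) _
  · ext j
    rw [truncate_apply]
    split_ifs with hj
    · rfl
    · exact (S.orbit_of_lt x (by omega)).symm

/-- The limit of a system of C*-algebras is also the limit of a system with surjective connecting
morphisms, made of tails of bounded sequences in the original system. -/
lemma isInductiveLimit_tail (h : IsInductiveLimit S.conn A μ) :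
    IsInductiveLimit (S.tailConn μ) A (S.tailLimit μ) where
  compat k := rfl
  dense_union := by
    refine h.dense_union.mono (iUnion_subset fun k => ?_)
    rintro _ ⟨x, rfl⟩
    exact mem_iUnion.2 ⟨k, ⟨_, boundedOrbit_mem_tail h le_rfl x⟩, rfl⟩
  norm_tendsto k p := by
    rw [tailLimit_apply]
    refine tendsto_order.2 ⟨fun c hc => .of_forall fun n => hc.trans_le ?_, fun c hc => ?_⟩
    · change ‖p.1.2‖ ≤ ‖(iterHom (S.tailConn μ) k n p : lp S.X ⊤ × A)‖
      rw [iterHom_tailConn_coe]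
      exact norm_snd_le (S.truncate (k + n) p.1.1, p.1.2)
    · obtain ⟨N, hN⟩ := eventually_atTop.1 (eventually_norm_lt_of_mem_closure h
        ((S.mem_tail μ).1 p.2).1 (half_pos (sub_pos.2 hc)))
      filter_upwards [eventually_ge_atTop N] with n hn
      change ‖(iterHom (S.tailConn μ) k n p : lp S.X ⊤ × A)‖ < c
      rw [iterHom_tailConn_coe]
      refine max_lt (lt_of_le_of_lt (b := (‖p.1.2‖ + c) / 2) ?_ (by linarith)) hc
      refine lp.norm_le_of_forall_le (by linarith [norm_nonneg p.1.2]) fun j => ?_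
      rw [truncate_apply]
      split_ifs with hj
      · linarith [(hN j (by omega)).1]
      · rw [norm_zero]
        linarith [norm_nonneg p.1.2]

/-- A weakly semiprojective inductive limit approximately factors through the system. -/
lemma exists_approx_section (h : IsInductiveLimit S.conn A μ) (hA : IsWeaklySemiprojective A)
    {ε : ℝ} (hε : 0 < ε) (F : Finset A) :
    ∃ (j : ℕ) (ψ : A →⋆ₙₐ[ℂ] S.X j), ∀ x ∈ F, ‖μ j (ψ x) - x‖ < ε := by
  obtain ⟨k, ψ, hψ⟩ := hA (fun k => S.tail μ k) (S.tailConn μ) (S.tailConn_surjective μ) A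
    (S.tailLimit μ) (isInductiveLimit_tail h) (NonUnitalStarAlgHom.id ℂ A) (ε / 2) (half_pos hε) F
  have hev : ∀ᶠ j in atTop, ∀ x ∈ F, ‖μ j ((ψ x).1.1 j) - (ψ x).1.2‖ < ε / 2 :=
    (eventually_all_finset F).2 fun x _ => (eventually_norm_lt_of_mem_closure h
      ((S.mem_tail μ).1 (ψ x).2).1 (half_pos hε)).mono fun j hj => hj.2
  obtain ⟨j, hj⟩ := hev.exists
  refine ⟨j, (S.eval j).comp ((NonUnitalStarAlgHom.fst ℂ (lp S.X ⊤) A).comp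
    ((NonUnitalStarSubalgebraClass.subtype (S.tail μ k)).comp ψ)), fun x hx => ?_⟩
  have h₁ : ‖(ψ x).1.2 - x‖ < ε / 2 := hψ x hx
  have h₂ := norm_sub_le_norm_sub_add_norm_sub (μ j ((ψ x).1.1 j)) (ψ x).1.2 x
  have h₃ := hj x hx
  change ‖μ j ((ψ x).1.1 j) - x‖ < ε
  linarith

end CStarInductiveSystem

end

open TopologicalSpace in
/-- A separable weakly semiprojective C*-algebra of trivial shape (i.e. an inductive limit
of projective C*-algebras) is weakly projective. -/
theorem weaklySemiprojective_trivialShape_implies_weaklyProjective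
    (A : Type u) [NonUnitalCStarAlgebra A] [SeparableSpace A]
    (hwsp : IsWeaklySemiprojective A) (hshape : IsInductiveLimitOfProjectives A) :
    IsWeaklyProjective A := by
  obtain ⟨S, μ, hμ, hproj⟩ := hshape
  intro C D _ _ π hπ σ ε hε F
  obtain ⟨j, ψ, hψ⟩ := CStarInductiveSystem.exists_approx_section hμ hwsp hε F
  obtain ⟨θ, hθ⟩ := hproj j C D π hπ (σ.comp (μ j))
  refine ⟨θ.comp ψ, fun x hx => ?_⟩
  have h : π (θ (ψ x)) = σ (μ j (ψ x)) := DFunLike.congr_fun hθ (ψ x)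
  change ‖π (θ (ψ x)) - σ x‖ < ε
  rw [h, ← map_sub]
  exact (NonUnitalStarAlgHom.norm_apply_le σ _).trans_lt (hψ x hx)
end
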